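/- Let μ be a mass distribution on ℝ³. Then there exists a triple of oriented planes (H₁, H₂, H₃) that eight-partitions μ and such that the line of intersection H₁ ∩ H₂ has a prescribed direction u ∈ S². -/

import Mathlib

open MeasureTheory
open scoped RealInnerProductSpace

noncomputable section

abbrev E3 := EuclideanSpace ℝ (Fin 3)

def halfSpace (v : E3) (a : ℝ) (s : Bool) : Set E3 :=
  if s then {x | a < ⟪v, x⟫} else {x | ⟪v, x⟫ < a}

/-- Open orthant determined by `k` oriented planes and a sign vector `α` (`true` = `+`). -/
def orthant {k : ℕ} (v : Fin k → E3) (a : Fin k → ℝ) (α : Fin k → Bool) : Set E3 :=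
  ⋂ i, halfSpace (v i) (a i) (α i)

/-- The alternating sum `F_α(ℋ, μ) = Σ_β (−1)^{p(α,β)} μ(O_β)`, where `p(α,β)` counts the
coordinates where both `α` and `β` are `−` (i.e. `false`). -/
def altSum {k : ℕ} (μ : Measure E3) (v : Fin k → E3) (a : Fin k → ℝ) (α : Fin k → Bool) : ℝ :=
  ∑ β : Fin k → Bool,
    (-1 : ℝ) ^ (Finset.univ.filter (fun i => α i = false ∧ β i = false)).card *
      (μ (orthant v a β)).toReal

def IsMassDistribution (μ : Measure E3) : Prop :=
  IsFiniteMeasure μ ∧ ∀ v : E3, v ≠ 0 → ∀ a : ℝ, μ {x | ⟪v, x⟫ = a} = 0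

/-! ### Topological part -/

lemma exists_clog {X : Type} [TopologicalSpace X] [SimplyConnectedSpace X]
    [LocallyPathConnectedSpace X] (g : X → ℂ) (hg : Continuous g) (h0 : ∀ x, g x ≠ 0) :
    ∃ L : X → ℂ, Continuous L ∧ ∀ x, Complex.exp (L x) = g x := by
  obtain ⟨a⟩ : Nonempty X := inferInstance
  obtain ⟨F, ⟨-, hF⟩, -⟩ := Complex.isCoveringMap_exp.existsUnique_continuousMap_lifts
    (A := X) ⟨fun x => (⟨g x, h0 x⟩ : {z : ℂ // z ≠ 0}), by fun_prop⟩ a (Complex.log (g a))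
    (by ext; simp [Complex.exp_log (h0 a)])
  refine ⟨F, F.continuous, fun x => ?_⟩
  have := congrFun hF x
  simpa using congrArg Subtype.val this

lemma const_of_exp {X : Type} [TopologicalSpace X] [PreconnectedSpace X]
    (f : X → ℂ) (hf : Continuous f) (e : ℂ) (h : ∀ x, Complex.exp (f x) = e) (x y : X) :
    f x = f y := by
  have := Complex.isCoveringMap_exp.eq_of_comp_eq (g₁ := f) (g₂ := fun _ => f y) hf
    continuous_const (by ext z; simp [h]) y rfl
  exact congrFun this x

/-- `(z,w)` is a nonzero eigenvector of the Hermitian matrix of `(φ,h)`. -/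
def IsSpin (φ : ℂ) (h : ℝ) (z w : ℂ) : Prop :=
  (z ≠ 0 ∨ w ≠ 0) ∧
  (h : ℂ) * z + φ * w = (Real.sqrt (‖φ‖ ^ 2 + h ^ 2) : ℝ) * z ∧
  (starRingEnd ℂ) φ * z - h * w = (Real.sqrt (‖φ‖ ^ 2 + h ^ 2) : ℝ) * w

lemma sqrt_sq_c (φ : ℂ) (h : ℝ) :
    ((Real.sqrt (‖φ‖ ^ 2 + h ^ 2) : ℝ) : ℂ) ^ 2 = φ * (starRingEnd ℂ) φ + h ^ 2 := by
  rw [Complex.mul_conj, Complex.normSq_eq_norm_sq, ← Complex.ofReal_pow, Real.sq_sqrt (by positivity)]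
  push_cast; ring

lemma spin_start (φ : ℂ) (h : ℝ) (hne : φ ≠ 0 ∨ h ≠ 0) : ∃ z w, IsSpin φ h z w := by
  have hs := sqrt_sq_c φ h
  by_cases hφ : φ = 0
  · subst hφ
    have hh : h ≠ 0 := by simpa using hne
    rcases lt_or_gt_of_ne hh with h1 | h1
    · refine ⟨0, 1, by simp, by simp, ?_⟩
      simp [Real.sqrt_sq_eq_abs, abs_of_neg h1]
    · refine ⟨1, 0, by simp, ?_, by simp⟩
      simp [Real.sqrt_sq_eq_abs, abs_of_pos h1]
  · refine ⟨φ, (Real.sqrt (‖φ‖ ^ 2 + h ^ 2) : ℝ) - h, by simp [hφ], by ring, ?_⟩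
    linear_combination -hs

lemma spin_step {φ φb : ℂ} {h h' : ℝ} {z w : ℂ} (hs : IsSpin φ h z w)
    (hna : (Real.sqrt (‖φb‖ ^ 2 + h' ^ 2) : ℝ) * φ + (Real.sqrt (‖φ‖ ^ 2 + h ^ 2) : ℝ) * φb ≠ 0 ∨
      Real.sqrt (‖φb‖ ^ 2 + h' ^ 2) * h + Real.sqrt (‖φ‖ ^ 2 + h ^ 2) * h' ≠ 0) :
    IsSpin φb h' ((Real.sqrt (‖φb‖ ^ 2 + h' ^ 2) : ℝ) * z + (h' * z + φb * w))
      ((Real.sqrt (‖φb‖ ^ 2 + h' ^ 2) : ℝ) * w + ((starRingEnd ℂ) φb * z - h' * w)) := by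
  obtain ⟨h0, h1, h2⟩ := hs
  have hs' := sqrt_sq_c φb h'
  set r := Real.sqrt (‖φ‖ ^ 2 + h ^ 2)
  set r' := Real.sqrt (‖φb‖ ^ 2 + h' ^ 2)
  refine ⟨?_, by linear_combination -z * hs', by linear_combination -w * hs'⟩
  by_contra hc
  push Not at hc
  obtain ⟨c1, c2⟩ := hc
  -- the combined matrix kills `(z,w)`
  set Φ : ℂ := (r' : ℂ) * φ + r * φb with hΦ
  set H : ℝ := r' * h + r * h' with hH
  have e1 : (H : ℂ) * z + Φ * w = 0 := by
    rw [hΦ, hH]; push_cast; linear_combination r' * h1 + r * c1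
  have e2 : (starRingEnd ℂ) Φ * z - H * w = 0 := by
    rw [hΦ, hH]
    simp only [map_add, map_mul, Complex.conj_ofReal]
    push_cast; linear_combination r' * h2 + r * c2
  have key : ((‖Φ‖ ^ 2 + H ^ 2 : ℝ) : ℂ) = Φ * (starRingEnd ℂ) Φ + H ^ 2 := by
    rw [Complex.mul_conj, Complex.normSq_eq_norm_sq]; push_cast; ring
  have e3 : ((‖Φ‖ ^ 2 + H ^ 2 : ℝ) : ℂ) * z = 0 := by
    rw [key]; linear_combination H * e1 + Φ * e2
  have e4 : ((‖Φ‖ ^ 2 + H ^ 2 : ℝ) : ℂ) * w = 0 := by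
    rw [key]; linear_combination (starRingEnd ℂ) Φ * e1 - H * e2
  have hz : ‖Φ‖ ^ 2 + H ^ 2 = 0 := by
    rcases h0 with h0 | h0
    · exact_mod_cast (mul_eq_zero.mp e3).resolve_right h0
    · exact_mod_cast (mul_eq_zero.mp e4).resolve_right h0
  rcases hna with hn | hn
  · have : 0 < ‖Φ‖ ^ 2 := by have := norm_pos_iff.mpr hn; positivity
    nlinarith [sq_nonneg H]
  · have : 0 < H ^ 2 := by positivity
    nlinarith [sq_nonneg ‖Φ‖]

/-- If two vectors are close then they are not antipodal. -/
lemma not_antipodal {φ φb : ℂ} {h h' : ℝ} (hne : φ ≠ 0 ∨ h ≠ 0)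
    (hc : dist (φ, h) (φb, h') < ‖(φ, h)‖) :
    (Real.sqrt (‖φb‖ ^ 2 + h' ^ 2) : ℝ) * φ + (Real.sqrt (‖φ‖ ^ 2 + h ^ 2) : ℝ) * φb ≠ 0 ∨
      Real.sqrt (‖φb‖ ^ 2 + h' ^ 2) * h + Real.sqrt (‖φ‖ ^ 2 + h ^ 2) * h' ≠ 0 := by
  by_contra hcon
  push Not at hcon
  obtain ⟨c1, c2⟩ := hcon
  have hr : 0 < Real.sqrt (‖φ‖ ^ 2 + h ^ 2) := by
    apply Real.sqrt_pos.mpr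
    rcases hne with hn | hn
    · have := norm_pos_iff.mpr hn; positivity
    · have : 0 < h ^ 2 := by positivity
      positivity
  have hr' : 0 ≤ Real.sqrt (‖φb‖ ^ 2 + h' ^ 2) := Real.sqrt_nonneg _
  set r := Real.sqrt (‖φ‖ ^ 2 + h ^ 2)
  set r' := Real.sqrt (‖φb‖ ^ 2 + h' ^ 2)
  have e : r • ((φ, h) - (φb, h')) = (r + r') • (φ, h) := by
    ext1
    · simp only [Prod.smul_fst, Prod.fst_sub, Complex.real_smul]; push_cast
      linear_combination -c1
    · simp only [Prod.smul_snd, Prod.snd_sub, smul_eq_mul]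
      linear_combination -c2
  have e' := congrArg norm e
  rw [norm_smul, norm_smul, Real.norm_of_nonneg hr.le, Real.norm_of_nonneg (by positivity),
    ← dist_eq_norm] at e'
  have : r * dist (φ, h) (φb, h') < r * ‖(φ, h)‖ := by gcongr
  have : 0 ≤ r' * ‖(φ, h)‖ := by positivity
  nlinarith

lemma spin_lift_seq {X : Type} [TopologicalSpace X] (φ : ℕ → X → ℂ) (h : ℕ → X → ℝ)
    (hφ : ∀ n, Continuous (φ n)) (hh : ∀ n, Continuous (h n))
    (hne : ∀ n x, φ n x ≠ 0 ∨ h n x ≠ 0)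
    (hcl : ∀ n x, dist (φ n x, h n x) (φ (n + 1) x, h (n + 1) x) < ‖(φ n x, h n x)‖)
    (h0 : ∀ x y, φ 0 x = φ 0 y ∧ h 0 x = h 0 y) (n : ℕ) :
    ∃ z w : X → ℂ, Continuous z ∧ Continuous w ∧ ∀ x, IsSpin (φ n x) (h n x) (z x) (w x) := by
  induction n with
  | zero =>
    rcases isEmpty_or_nonempty X with hX | ⟨⟨a⟩⟩
    · exact ⟨fun _ => 0, fun _ => 0, by fun_prop, by fun_prop, fun x => hX.elim x⟩
    · obtain ⟨z, w, hzw⟩ := spin_start _ _ (hne 0 a)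
      refine ⟨fun _ => z, fun _ => w, by fun_prop, by fun_prop, fun x => ?_⟩
      rw [(h0 x a).1, (h0 x a).2]; exact hzw
  | succ n ih =>
    obtain ⟨z, w, hz, hw, H⟩ := ih
    have a1 := hφ (n + 1)
    have a2 := hh (n + 1)
    have a3 : Continuous fun x => ((Real.sqrt (‖φ (n + 1) x‖ ^ 2 + h (n + 1) x ^ 2) : ℝ) : ℂ) := by
      fun_prop
    have a4 : Continuous fun x => (starRingEnd ℂ) (φ (n + 1) x) :=
      Complex.continuous_conj.comp a1
    refine ⟨_, _, ?_, ?_, fun x => spin_step (H x) (not_antipodal (hne n x) (hcl n x))⟩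
    · fun_prop
    · fun_prop

lemma spin_lift (φ : ℝ × ℂ → ℂ) (h : ℝ × ℂ → ℝ) (hφ : Continuous φ) (hh : Continuous h)
    (hne : ∀ x, φ x ≠ 0 ∨ h x ≠ 0) :
    ∃ z w : Metric.closedBall (0 : ℝ × ℂ) 1 → ℂ, Continuous z ∧ Continuous w ∧
      ∀ x : Metric.closedBall (0 : ℝ × ℂ) 1, IsSpin (φ x) (h x) (z x) (w x) := by
  set K := Metric.closedBall (0 : ℝ × ℂ) 1
  have hK : IsCompact K := isCompact_closedBall _ _
  have hG : Continuous fun x => (φ x, h x) := by fun_prop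
  obtain ⟨δ, hδ, hδK⟩ : ∃ δ > 0, ∀ x ∈ K, δ ≤ ‖(φ x, h x)‖ := by
    obtain ⟨x0, hx0, hm⟩ := hK.exists_isMinOn ⟨0, by simp [K]⟩ hG.norm.continuousOn
    refine ⟨_, ?_, fun x hx => hm hx⟩
    apply norm_pos_iff.mpr
    intro hc
    rw [Prod.mk_eq_zero] at hc
    rcases hne x0 with h1 | h1
    · exact h1 hc.1
    · exact h1 hc.2
  have huc := hK.uniformContinuousOn_of_continuous hG.continuousOn
  rw [Metric.uniformContinuousOn_iff] at huc
  obtain ⟨ε, hε, hu⟩ := huc δ hδ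
  obtain ⟨N, hN⟩ := exists_nat_one_div_lt hε
  have hN0 : (0 : ℝ) < N + 1 := by positivity
  set c : ℕ → ℝ := fun n => min (n / (N + 1)) 1 with hc
  have c0 : ∀ n, 0 ≤ c n := fun n => by simp only [hc]; positivity
  have c1 : ∀ n, c n ≤ 1 := fun n => min_le_right _ _
  have cK : ∀ n, ∀ x ∈ K, c n • x ∈ K := by
    intro n x hx
    simp only [K, mem_closedBall_zero_iff] at hx ⊢
    rw [norm_smul, Real.norm_of_nonneg (c0 n)]
    nlinarith [c1 n, c0 n, norm_nonneg x]
  have cd : ∀ n, |c n - c (n + 1)| ≤ 1 / (N + 1) := by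
    intro n
    refine (abs_min_sub_min_le_max _ _ _ _).trans ?_
    simp only [sub_self, abs_zero, Nat.cast_add, Nat.cast_one]
    rw [← sub_div, abs_div, abs_of_pos hN0]
    apply max_le
    · gcongr; simp
    · positivity
  have := spin_lift_seq (X := K) (fun n x => φ (c n • (x : ℝ × ℂ))) (fun n x => h (c n • (x : ℝ × ℂ)))
    (fun n => by fun_prop) (fun n => by fun_prop) (fun n x => hne _) (fun n x => ?_)
    (fun x y => by simp [hc]) (N + 1)
  · obtain ⟨z, w, hz, hw, H⟩ := this
    refine ⟨z, w, hz, hw, fun x => ?_⟩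
    have : c (N + 1) = 1 := by simp [hc, hN0.ne']
    simpa [this] using H x
  · refine lt_of_lt_of_le (hu _ (cK n x x.2) _ (cK (n + 1) x x.2) ?_) (hδK _ (cK n x x.2))
    rw [dist_eq_norm, ← sub_smul, norm_smul, Real.norm_eq_abs]
    have hx : ‖(x : ℝ × ℂ)‖ ≤ 1 := mem_closedBall_zero_iff.mp x.2
    calc _ ≤ 1 / ((N : ℝ) + 1) * 1 := by gcongr; exact cd n
      _ < ε := by simpa using hN

lemma spin_det {φ : ℂ} {h : ℝ} {z w z' w' : ℂ} (hne : φ ≠ 0 ∨ h ≠ 0) (h1 : IsSpin φ h z w)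
    (h2 : IsSpin φ h z' w') : z * w' = w * z' := by
  obtain ⟨-, a1, a2⟩ := h1
  obtain ⟨-, b1, b2⟩ := h2
  set r := Real.sqrt (‖φ‖ ^ 2 + h ^ 2)
  have e1 : φ * (z * w' - w * z') = 0 := by linear_combination z * b1 - z' * a1
  have e2 : ((h : ℂ) - r) * (z * w' - w * z') = 0 := by linear_combination w' * a1 - w * b1
  have e3 : ((h : ℂ) + r) * (z * w' - w * z') = 0 := by linear_combination z' * a2 - z * b2
  have e4 : (h : ℂ) * (z * w' - w * z') = 0 := by linear_combination (e2 + e3) / 2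
  rcases hne with hn | hn
  · exact sub_eq_zero.mp ((mul_eq_zero.mp e1).resolve_left hn)
  · exact sub_eq_zero.mp ((mul_eq_zero.mp e4).resolve_left (by exact_mod_cast hn))

lemma spin_flip {φ : ℂ} {h : ℝ} {z w : ℂ} (hs : IsSpin φ h z w) :
    IsSpin (-Complex.I * φ) (-h) (-Complex.I * (starRingEnd ℂ) w) ((starRingEnd ℂ) z) := by
  obtain ⟨h0, h1, h2⟩ := hs
  have e : ‖-Complex.I * φ‖ ^ 2 + (-h) ^ 2 = ‖φ‖ ^ 2 + h ^ 2 := by simp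
  have g1 := congrArg (starRingEnd ℂ) h1
  have g2 := congrArg (starRingEnd ℂ) h2
  simp only [map_add, map_sub, map_mul, Complex.conj_ofReal, Complex.conj_conj] at g1 g2
  refine ⟨?_, ?_, ?_⟩
  · rcases h0 with h0 | h0
    · right; simpa using h0
    · left; simpa using h0
  · rw [e]; push_cast; linear_combination -Complex.I * g2
  · rw [e]
    simp only [map_mul, map_neg, Complex.conj_I]
    push_cast
    linear_combination g1 - (starRingEnd ℂ) φ * (starRingEnd ℂ) w * Complex.I_sq

lemma top_core (φ : ℝ × ℂ → ℂ) (h : ℝ × ℂ → ℝ) (z w : ℝ × ℂ → ℂ) (hφ : Continuous φ)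
    (hh : Continuous h) (hz : Continuous z) (hw : Continuous w)
    (hs : ∀ x, IsSpin (φ x) (h x) (z x) (w x))
    (hne : ∀ x, φ x ≠ 0 ∨ h x ≠ 0)
    (hb : ∀ t ζ, ‖ζ‖ = 1 → φ (t, ζ) ≠ 0)
    (hodd : ∀ t ζ, ‖ζ‖ = 1 → φ (t, -ζ) = -φ (t, ζ))
    (hφ1 : ∀ ζ, φ (1, ζ) = -Complex.I * φ (0, ζ))
    (hh1 : ∀ ζ, h (1, ζ) = -h (0, ζ)) : False := by
  have hzb : ∀ t ζ, ‖ζ‖ = 1 → z (t, ζ) ≠ 0 := by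
    intro t ζ hζ hc
    obtain ⟨h0, h1, h2⟩ := hs (t, ζ)
    have hb' := hb t ζ hζ
    rw [hc, mul_zero, mul_zero, zero_add, mul_eq_zero] at h1
    exact h0.elim (fun h => h hc) (fun h => h (h1.resolve_left hb'))
  have hwb : ∀ t ζ, ‖ζ‖ = 1 → w (t, ζ) ≠ 0 := by
    intro t ζ hζ hc
    obtain ⟨h0, h1, h2⟩ := hs (t, ζ)
    have hb' : (starRingEnd ℂ) (φ (t, ζ)) ≠ 0 := by simpa using hb t ζ hζ
    rw [hc, mul_zero, mul_zero, sub_zero, mul_eq_zero] at h2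
    exact h0.elim (fun h => h (h2.resolve_left hb')) (fun h => h hc)
  have hE : ∀ s : ℝ, ‖Complex.exp (s * Complex.I)‖ = 1 := Complex.norm_exp_ofReal_mul_I
  obtain ⟨Z, hZ, hZe⟩ := exists_clog (X := ℝ × ℝ) (fun p => z (p.1, Complex.exp (p.2 * Complex.I)))
    (by fun_prop) (fun p => hzb _ _ (hE _))
  obtain ⟨W, hW, hWe⟩ := exists_clog (X := ℝ × ℝ) (fun p => w (p.1, Complex.exp (p.2 * Complex.I)))
    (by fun_prop) (fun p => hwb _ _ (hE _))
  have hE2 : ∀ s : ℝ, Complex.exp (((s + 2 * Real.pi : ℝ) : ℂ) * Complex.I)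
      = Complex.exp (s * Complex.I) := by
    intro s
    push_cast
    rw [add_mul, Complex.exp_add, Complex.exp_two_pi_mul_I, mul_one]
  have hE1 : ∀ s : ℝ, Complex.exp (((s + Real.pi : ℝ) : ℂ) * Complex.I)
      = -Complex.exp (s * Complex.I) := by
    intro s
    push_cast
    rw [add_mul, Complex.exp_add, Complex.exp_pi_mul_I, mul_neg, mul_one]
  -- periods
  have pz : ∀ p q : ℝ × ℝ, Z (p.1, p.2 + 2 * Real.pi) - Z p = Z (q.1, q.2 + 2 * Real.pi) - Z q := by
    intro p q
    refine const_of_exp (fun p : ℝ × ℝ => Z (p.1, p.2 + 2 * Real.pi) - Z p) (by fun_prop) 1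
      (fun p => ?_) p q
    rw [Complex.exp_sub, hZe, hZe, hE2, div_self (hzb _ _ (hE _))]
  have ew : ∀ p : ℝ × ℝ, Complex.exp (W (p.1, p.2 + 2 * Real.pi) - W p) = 1 := by
    intro p
    rw [Complex.exp_sub, hWe, hWe, hE2, div_self (hwb _ _ (hE _))]
  -- the boundary function
  have hpos : ∀ t ζ, ‖ζ‖ = 1 → 0 < Real.sqrt (‖φ (t, ζ)‖ ^ 2 + h (t, ζ) ^ 2) - h (t, ζ) := by
    intro t ζ hζ
    rw [sub_pos]
    apply Real.lt_sqrt_of_sq_lt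
    have := norm_pos_iff.mpr (hb t ζ hζ)
    have : 0 < ‖φ (t, ζ)‖ ^ 2 := by positivity
    linarith
  set ρ : ℝ → ℝ := fun s => Real.sqrt (‖φ (0, Complex.exp (s * Complex.I))‖ ^ 2
    + h (0, Complex.exp (s * Complex.I)) ^ 2) - h (0, Complex.exp (s * Complex.I)) with hρ
  have hρc : Continuous ρ := by fun_prop
  have hρp : ∀ s, 0 < ρ s := fun s => hpos _ _ (hE s)
  set Φ : ℝ → ℂ := fun s => Z (0, s) - W (0, s) + (Real.log (ρ s) : ℝ) with hΦ
  have hΦc : Continuous Φ := by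
    have : Continuous fun s => Real.log (ρ s) := hρc.log (fun s => (hρp s).ne')
    fun_prop
  have hΦe : ∀ s : ℝ, Complex.exp (Φ s) = φ (0, Complex.exp (s * Complex.I)) := by
    intro s
    have hw0 := hwb 0 _ (hE s)
    rw [hΦ]
    simp only
    rw [Complex.exp_add, Complex.exp_sub, hZe, hWe, ← Complex.ofReal_exp, Real.exp_log (hρp s),
      div_mul_eq_mul_div, div_eq_iff hw0]
    obtain ⟨h0, h1, h2⟩ := hs (0, Complex.exp (s * Complex.I))
    rw [hρ]; push_cast
    linear_combination -h1
  have eΦ : ∀ s, Complex.exp (Φ (s + Real.pi) - Φ s) = -1 := by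
    intro s
    rw [Complex.exp_sub, hΦe, hΦe, hE1, hodd _ _ (hE s), neg_div, div_self (hb _ _ (hE s))]
  have cΦ : ∀ s s', Φ (s + Real.pi) - Φ s = Φ (s' + Real.pi) - Φ s' := fun s s' =>
    const_of_exp (fun s => Φ (s + Real.pi) - Φ s) (by fun_prop) (-1) eΦ s s'
  have hρ2 : ρ (0 + 2 * Real.pi) = ρ 0 := by
    simp only [hρ]; rw [hE2]
  -- comparison of times `0` and `1`
  set c : ℂ → ℂ := fun ζ => z (1, ζ) * (starRingEnd ℂ) (-Complex.I * (starRingEnd ℂ) (w (0, ζ)))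
    + w (1, ζ) * (starRingEnd ℂ) ((starRingEnd ℂ) (z (0, ζ))) with hc
  have hcc : Continuous c := by
    have := Complex.continuous_conj
    fun_prop
  have hdet : ∀ ζ, z (1, ζ) * (starRingEnd ℂ) (z (0, ζ))
      = w (1, ζ) * (-Complex.I * (starRingEnd ℂ) (w (0, ζ))) := by
    intro ζ
    have a := spin_flip (hs (0, ζ))
    rw [← hφ1, ← hh1] at a
    exact spin_det (hne _) (hs (1, ζ)) a
  have hN : ∀ ζ, z (0, ζ) * (starRingEnd ℂ) (z (0, ζ)) + w (0, ζ) * (starRingEnd ℂ) (w (0, ζ))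
      = ((‖z (0, ζ)‖ ^ 2 + ‖w (0, ζ)‖ ^ 2 : ℝ) : ℂ) := by
    intro ζ
    rw [Complex.mul_conj, Complex.mul_conj, Complex.normSq_eq_norm_sq, Complex.normSq_eq_norm_sq]
    push_cast; ring
  have hNp : ∀ ζ, 0 < ‖z (0, ζ)‖ ^ 2 + ‖w (0, ζ)‖ ^ 2 := by
    intro ζ
    rcases (hs (0, ζ)).1 with h0 | h0
    · have := norm_pos_iff.mpr h0; positivity
    · have := norm_pos_iff.mpr h0; positivity
  have c1 : ∀ ζ, z (1, ζ) * ((‖z (0, ζ)‖ ^ 2 + ‖w (0, ζ)‖ ^ 2 : ℝ) : ℂ)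
      = c ζ * (-Complex.I * (starRingEnd ℂ) (w (0, ζ))) := by
    intro ζ
    rw [← hN, hc]
    simp only [map_mul, map_neg, Complex.conj_I, Complex.conj_conj]
    linear_combination z (0, ζ) * hdet ζ
      + z (1, ζ) * w (0, ζ) * (starRingEnd ℂ) (w (0, ζ)) * Complex.I_sq
  have c2 : ∀ ζ, w (1, ζ) * ((‖z (0, ζ)‖ ^ 2 + ‖w (0, ζ)‖ ^ 2 : ℝ) : ℂ)
      = c ζ * (starRingEnd ℂ) (z (0, ζ)) := by
    intro ζ
    rw [← hN, hc]
    simp only [map_mul, map_neg, Complex.conj_I, Complex.conj_conj]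
    linear_combination -Complex.I * w (0, ζ) * hdet ζ
      + w (1, ζ) * w (0, ζ) * (starRingEnd ℂ) (w (0, ζ)) * Complex.I_sq
  have hc0 : ∀ ζ, c ζ ≠ 0 := by
    intro ζ h0
    have e1 := c1 ζ
    have e2 := c2 ζ
    have hp : ((‖z (0, ζ)‖ ^ 2 + ‖w (0, ζ)‖ ^ 2 : ℝ) : ℂ) ≠ 0 := by exact_mod_cast (hNp ζ).ne'
    rw [h0, zero_mul, mul_eq_zero] at e1 e2
    rcases (hs (1, ζ)).1 with h3 | h3
    · exact h3 (e1.resolve_right hp)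
    · exact h3 (e2.resolve_right hp)
  obtain ⟨C, hC, hCe⟩ := exists_clog c hcc hc0
  set n : ℝ → ℝ := fun s => ‖z (0, Complex.exp (s * Complex.I))‖ ^ 2
    + ‖w (0, Complex.exp (s * Complex.I))‖ ^ 2 with hn
  have hnc : Continuous n := by fun_prop
  have hnp : ∀ s, 0 < n s := fun s => hNp _
  have hlc : Continuous fun s => Real.log (n s) := hnc.log (fun s => (hnp s).ne')
  set Q : ℝ → ℂ := fun s => Z (1, s) + (Real.log (n s) : ℝ) - C (Complex.exp (s * Complex.I))
    - (starRingEnd ℂ) (W (0, s)) with hQ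
  have hQc : Continuous Q := by
    have := Complex.continuous_conj
    fun_prop
  have hQe : ∀ s, Complex.exp (Q s) = -Complex.I := by
    intro s
    have hw0 := hwb 0 _ (hE s)
    simp only [hQ]
    rw [Complex.exp_sub, Complex.exp_sub, Complex.exp_add, hZe, hCe, Complex.exp_conj, hWe,
      ← Complex.ofReal_exp, Real.exp_log (hnp s), div_div, div_eq_iff, c1]
    · ring
    · exact mul_ne_zero (hc0 _) (by simpa using hw0)
  have hQ2 := const_of_exp Q hQc _ hQe (0 + 2 * Real.pi) 0
  have hn2 : n (0 + 2 * Real.pi) = n 0 := by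
    simp only [hn]; rw [hE2]
  obtain ⟨k, hk⟩ := Complex.exp_eq_one_iff.mp (ew (0, 0))
  have hk' := congrArg (starRingEnd ℂ) hk
  simp only [map_sub, map_mul, Complex.conj_I, Complex.conj_ofReal, map_ofNat, map_intCast] at hk'
  have e0 := eΦ 0
  have e1 := cΦ 0 Real.pi
  have e2 := pz (0, 0) (1, 0)
  have e4 : Real.pi + Real.pi = 0 + 2 * Real.pi := by ring
  simp only [hQ] at hQ2
  rw [hn2, hE2] at hQ2
  rw [e4] at e1
  simp only [hΦ] at e1 e0
  rw [hρ2] at e1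
  simp only at e2 hk hk'
  have fin : Z (0, 0 + Real.pi) - W (0, 0 + Real.pi) + (Real.log (ρ (0 + Real.pi)) : ℝ)
      - (Z (0, 0) - W (0, 0) + (Real.log (ρ 0) : ℝ)) = ((-k : ℤ) : ℂ) * (2 * Real.pi * Complex.I) := by
    simp only [zero_add] at e1 e2 hk hk' hQ2 ⊢
    push_cast
    linear_combination e1 / 2 + e2 / 2 - hk / 2 + hk' / 2 + hQ2 / 2
  rw [fin, Complex.exp_int_mul_two_pi_mul_I] at e0
  norm_num at e0

lemma top_lemma (φ : ℝ × ℂ → ℂ) (h : ℝ × ℂ → ℝ) (hφ : Continuous φ) (hh : Continuous h)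
    (hb : ∀ t ζ, ‖ζ‖ = 1 → φ (t, ζ) ≠ 0)
    (hodd : ∀ t ζ, ‖ζ‖ = 1 → φ (t, -ζ) = -φ (t, ζ))
    (hφ1 : ∀ ζ, φ (1, ζ) = -Complex.I * φ (0, ζ))
    (hh1 : ∀ ζ, h (1, ζ) = -h (0, ζ)) : ∃ x, φ x = 0 ∧ h x = 0 := by
  by_contra hcon
  have hne : ∀ x, φ x ≠ 0 ∨ h x ≠ 0 := by
    intro x
    by_contra hc
    push Not at hc
    exact hcon ⟨x, hc⟩
  obtain ⟨z, w, hz, hw, H⟩ := spin_lift φ h hφ hh hne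
  set κ : ℝ × ℂ → ℝ × ℂ := fun p => (max 0 (min p.1 1), ((max 1 ‖p.2‖)⁻¹ : ℝ) • p.2) with hκ
  have hκc : Continuous κ := by
    have : Continuous fun p : ℝ × ℂ => (max 1 ‖p.2‖)⁻¹ :=
      Continuous.inv₀ (by fun_prop) (fun p => (lt_of_lt_of_le one_pos (le_max_left _ _)).ne')
    fun_prop
  have hκK : ∀ p, κ p ∈ Metric.closedBall (0 : ℝ × ℂ) 1 := by
    intro p
    rw [mem_closedBall_zero_iff, Prod.norm_def]
    simp only [hκ]
    have h1 : 0 < max 1 ‖p.2‖ := lt_of_lt_of_le one_pos (le_max_left _ _)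
    apply max_le
    · rw [Real.norm_of_nonneg (le_max_left _ _)]
      exact max_le zero_le_one (min_le_right _ _)
    · rw [norm_smul, norm_inv, Real.norm_of_nonneg h1.le, inv_mul_le_one₀ h1]
      exact le_max_right _ _
  have hκ1 : ∀ t ζ, ‖ζ‖ = 1 → κ (t, ζ) = (max 0 (min t 1), ζ) := by
    intro t ζ hζ
    simp [hκ, hζ]
  have hκt : ∀ ζ, κ (1, ζ) = (1, (κ (0, ζ)).2) ∧ κ (0, ζ) = (0, (κ (0, ζ)).2) := by
    intro ζ
    simp [hκ]
  refine top_core (φ ∘ κ) (h ∘ κ) (fun p => z ⟨κ p, hκK p⟩) (fun p => w ⟨κ p, hκK p⟩)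
    (hφ.comp hκc) (hh.comp hκc) (by fun_prop) (by fun_prop) (fun p => H ⟨κ p, hκK p⟩)
    (fun p => hne _) ?_ ?_ ?_ ?_
  · intro t ζ hζ
    simp only [Function.comp, hκ1 t ζ hζ]
    exact hb _ _ hζ
  · intro t ζ hζ
    simp only [Function.comp, hκ1 t ζ hζ, hκ1 t (-ζ) (by simpa using hζ)]
    exact hodd _ _ hζ
  · intro ζ
    simp only [Function.comp]
    rw [(hκt ζ).1, (hκt ζ).2]
    exact hφ1 _
  · intro ζ
    simp only [Function.comp]
    rw [(hκt ζ).1, (hκt ζ).2]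
    exact hh1 _

/-! ### Measures of intersections of half-spaces -/

/-- open half space of an oriented plane -/
def hsp (p : E3 × ℝ) : Set E3 := {x | p.2 < ⟪p.1, x⟫}

lemma mem_hsp {p : E3 × ℝ} {x : E3} : x ∈ hsp p ↔ p.2 < ⟪p.1, x⟫ := Iff.rfl

lemma mem_hsp_neg {p : E3 × ℝ} {x : E3} : x ∈ hsp (-p) ↔ ⟪p.1, x⟫ < p.2 := by
  simp [hsp, inner_neg_left]

lemma isOpen_hsp (p : E3 × ℝ) : IsOpen (hsp p) := by
  unfold hsp
  exact isOpen_lt (by fun_prop) (by fun_prop)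

lemma hsp_meas (p : E3 × ℝ) : MeasurableSet (hsp p) := (isOpen_hsp p).measurableSet

def PlaneNull (μ : Measure E3) : Prop := ∀ v : E3, v ≠ 0 → ∀ a : ℝ, μ {x | ⟪v, x⟫ = a} = 0

lemma tendsto_inter (μ : Measure E3) [IsFiniteMeasure μ] (hn : PlaneNull μ) {ι β : Type}
    [Fintype ι] (L : Filter β) [L.IsCountablyGenerated] (P : β → ι → E3 × ℝ) (p : ι → E3 × ℝ)
    (hP : Filter.Tendsto P L (nhds p)) (h0 : ∀ i, (p i).1 ≠ 0) :
    Filter.Tendsto (fun b => μ (⋂ i, hsp (P b i))) L (nhds (μ (⋂ i, hsp (p i)))) := by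
  apply tendsto_measure_of_ae_tendsto_indicator_of_isFiniteMeasure
  · exact MeasurableSet.iInter fun i => hsp_meas _
  · exact fun b => MeasurableSet.iInter fun i => hsp_meas _
  · have hae : ∀ᵐ x ∂μ, ∀ i, ⟪(p i).1, x⟫ ≠ (p i).2 := by
      rw [ae_all_iff]
      intro i
      rw [ae_iff]
      simpa using hn _ (h0 i) (p i).2
    filter_upwards [hae] with x hx
    have : ∀ i, ∀ᶠ b in L, (x ∈ hsp (P b i) ↔ x ∈ hsp (p i)) := by
      intro i
      have hPi : Filter.Tendsto (fun b => P b i) L (nhds (p i)) := (tendsto_pi_nhds.mp hP) i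
      have hc : Continuous fun q : E3 × ℝ => ⟪q.1, x⟫ - q.2 := by fun_prop
      have ht := (hc.tendsto (p i)).comp hPi
      rcases lt_or_gt_of_ne (hx i) with h1 | h1
      · filter_upwards [ht.eventually_lt_const (sub_neg.mpr h1)] with b hb
        simp only [mem_hsp, Function.comp] at hb ⊢
        constructor <;> intro h2 <;> linarith
      · filter_upwards [ht.eventually_const_lt (sub_pos.mpr h1)] with b hb
        simp only [mem_hsp, Function.comp] at hb ⊢
        constructor <;> intro h2 <;> linarith
    filter_upwards [Filter.eventually_all.mpr this] with b hb
    simp only [Set.mem_iInter]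
    exact forall_congr' hb

def mP (μ : Measure E3) (p : E3 × ℝ) : ℝ := μ.real (hsp p)
def mQ (μ : Measure E3) (p q : E3 × ℝ) : ℝ := μ.real (hsp p ∩ hsp q)
def mR (μ : Measure E3) (p q r : E3 × ℝ) : ℝ := μ.real (hsp p ∩ hsp q ∩ hsp r)

lemma cont_mR (μ : Measure E3) [IsFiniteMeasure μ] (hn : PlaneNull μ) {Y : Type}
    [TopologicalSpace Y] [FirstCountableTopology Y] (p q r : Y → E3 × ℝ)
    (hp : Continuous p) (hq : Continuous q) (hr : Continuous r)
    (hp0 : ∀ y, (p y).1 ≠ 0) (hq0 : ∀ y, (q y).1 ≠ 0) (hr0 : ∀ y, (r y).1 ≠ 0) :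
    Continuous fun y => mR μ (p y) (q y) (r y) := by
  rw [continuous_iff_continuousAt]
  intro y
  have hc : Continuous fun y => (![p y, q y, r y] : Fin 3 → E3 × ℝ) := by
    refine continuous_pi fun i => ?_
    fin_cases i <;> simpa
  have := tendsto_inter μ hn (nhds y) (fun y => ![p y, q y, r y]) ![p y, q y, r y] (hc.tendsto y)
    (by intro i; fin_cases i <;> simp [hp0, hq0, hr0])
  have h2 := (ENNReal.tendsto_toReal (measure_ne_top μ _)).comp this
  have e : ∀ y, mR μ (p y) (q y) (r y) =
      (μ (⋂ i, hsp ((![p y, q y, r y] : Fin 3 → E3 × ℝ) i))).toReal := by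
    intro y
    unfold mR Measure.real
    congr 2
    ext x
    simp [Fin.forall_fin_succ, and_assoc]
  unfold ContinuousAt
  simp only
  rw [e y]
  refine h2.congr (fun y => (e y).symm)

lemma mR_self (μ : Measure E3) (p q : E3 × ℝ) : mR μ p q q = mQ μ p q := by
  simp [mR, mQ, Set.inter_assoc]

lemma mQ_self (μ : Measure E3) (p : E3 × ℝ) : mQ μ p p = mP μ p := by
  simp [mP, mQ]

lemma mQ_comm (μ : Measure E3) (p q : E3 × ℝ) : mQ μ p q = mQ μ q p := by
  simp [mQ, Set.inter_comm]

lemma mR_comm (μ : Measure E3) (p q r : E3 × ℝ) : mR μ p q r = mR μ q p r := by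
  simp [mR, Set.inter_comm (hsp p)]

lemma split_real (μ : Measure E3) [IsFiniteMeasure μ] (hn : PlaneNull μ) (S : Set E3)
    (r : E3 × ℝ) (hr : r.1 ≠ 0) :
    μ.real (S ∩ hsp r) + μ.real (S ∩ hsp (-r)) = μ.real S := by
  rw [← measureReal_inter_add_sdiff (μ := μ) (s := S) (hsp_meas r)]
  congr 1
  apply measureReal_congr
  have : ∀ᵐ x ∂μ, ⟪r.1, x⟫ ≠ r.2 := by
    rw [ae_iff]; simpa using hn _ hr r.2
  filter_upwards [this] with x hx
  apply propext
  change x ∈ S ∩ hsp (-r) ↔ x ∈ S \ hsp r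
  rw [Set.mem_inter_iff, Set.mem_sdiff, mem_hsp_neg, mem_hsp, not_lt]
  exact and_congr_right fun _ => ⟨le_of_lt, fun h => lt_of_le_of_ne h hx⟩

lemma split_R (μ : Measure E3) [IsFiniteMeasure μ] (hn : PlaneNull μ) (p q r : E3 × ℝ)
    (hr : r.1 ≠ 0) : mR μ p q r + mR μ p q (-r) = mQ μ p q := split_real μ hn _ r hr

lemma split_Q (μ : Measure E3) [IsFiniteMeasure μ] (hn : PlaneNull μ) (p q : E3 × ℝ)
    (hq : q.1 ≠ 0) : mQ μ p q + mQ μ p (-q) = mP μ p := split_real μ hn _ q hq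

lemma split_P (μ : Measure E3) [IsFiniteMeasure μ] (hn : PlaneNull μ) (p : E3 × ℝ)
    (hp : p.1 ≠ 0) : mP μ p + mP μ (-p) = μ.real Set.univ := by
  simpa [mP] using split_real μ hn Set.univ p hp

lemma neg_fst_ne {p : E3 × ℝ} (hp : p.1 ≠ 0) : (-p).1 ≠ 0 := by simpa using hp

lemma real_lt (μ : Measure E3) [IsFiniteMeasure μ] [μ.IsOpenPosMeasure] {A B C : Set E3}
    (hAB : A ⊆ B) (hC : IsOpen C) (hCn : C.Nonempty) (hCB : C ⊆ B) (hd : Disjoint A C) :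
    μ.real A < μ.real B := by
  have h1 : μ.real (A ∪ C) = μ.real A + μ.real C := measureReal_union hd hC.measurableSet
  have h2 : μ.real (A ∪ C) ≤ μ.real B := measureReal_mono (Set.union_subset hAB hCB)
  have h3 : 0 < μ.real C := ENNReal.toReal_pos (hC.measure_pos μ hCn).ne' (measure_ne_top _ _)
  linarith

lemma real_pos (μ : Measure E3) [IsFiniteMeasure μ] [μ.IsOpenPosMeasure] {C : Set E3}
    (hC : IsOpen C) (hCn : C.Nonempty) : 0 < μ.real C :=
  ENNReal.toReal_pos (hC.measure_pos μ hCn).ne' (measure_ne_top _ _)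

lemma implicit_cont {X : Type} [TopologicalSpace X] (F : X → ℝ → ℝ) (S : Set ℝ) (hS : IsOpen S)
    (hF : ∀ y ∈ S, Continuous fun x => F x y) (ha : ∀ x, StrictAntiOn (F x) S) (C : ℝ)
    (g : X → ℝ) (hg : ∀ x, g x ∈ S) (hgC : ∀ x, F x (g x) = C) : Continuous g := by
  rw [continuous_iff_continuousAt]
  intro x0
  rw [ContinuousAt, Metric.tendsto_nhds]
  intro ε hε
  obtain ⟨δ, hδ, hb⟩ := Metric.isOpen_iff.mp hS _ (hg x0)
  set η := min (ε / 2) (δ / 2) with hη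
  have hη0 : 0 < η := by positivity
  have hηδ : η < δ := lt_of_le_of_lt (min_le_right _ _) (by linarith)
  have hηε : η < ε := lt_of_le_of_lt (min_le_left _ _) (by linarith)
  have m1 : g x0 + η ∈ S := hb (by simp [abs_of_pos hη0, hηδ])
  have m2 : g x0 - η ∈ S := hb (by simp [abs_of_pos hη0, hηδ])
  have l1 : F x0 (g x0 + η) < C := by
    rw [← hgC x0]; exact ha x0 (hg x0) m1 (by linarith)
  have l2 : C < F x0 (g x0 - η) := by
    rw [← hgC x0]; exact ha x0 m2 (hg x0) (by linarith)
  filter_upwards [((hF _ m1).tendsto x0).eventually_lt_const l1,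
    ((hF _ m2).tendsto x0).eventually_const_lt l2] with x h1 h2
  rw [← hgC x] at h1 h2
  have k1 : g x < g x0 + η := ((ha x).lt_iff_gt m1 (hg x)).mp h1
  have k2 : g x0 - η < g x := ((ha x).lt_iff_gt (hg x) m2).mp h2
  rw [Real.dist_eq, abs_lt]
  constructor <;> linarith

abbrev NZ := {v : E3 // v ≠ 0}

lemma mP_anti (μ : Measure E3) [IsFiniteMeasure μ] [μ.IsOpenPosMeasure] (v : E3) (hv : v ≠ 0) :
    StrictAnti fun c => mP μ (v, c) := by
  intro a b hab
  have hvv : ⟪v, v⟫ ≠ 0 := by simpa using hv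
  apply real_lt μ (C := {x | a < ⟪v, x⟫} ∩ {x | ⟪v, x⟫ < b})
  · intro x hx
    simp only [mem_hsp] at hx ⊢
    linarith
  · exact (isOpen_lt (by fun_prop) (by fun_prop)).inter (isOpen_lt (by fun_prop) (by fun_prop))
  · refine ⟨((a + b) / 2 / ⟪v, v⟫) • v, ?_⟩
    simp only [Set.mem_inter_iff, Set.mem_ofPred_eq, inner_smul_right, div_mul_cancel₀ _ hvv]
    constructor <;> linarith
  · exact fun x hx => hx.1
  · rw [Set.disjoint_left]
    intro x hx h2
    have h3 := h2.2
    simp only [mem_hsp, Set.mem_ofPred_eq] at hx h3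
    linarith

lemma exists_med (μ : Measure E3) [IsFiniteMeasure μ] (hn : PlaneNull μ) [μ.IsOpenPosMeasure] :
    ∃ c : NZ → ℝ, Continuous c ∧ (∀ v : NZ, mP μ (v, c v) = μ.real Set.univ / 2) ∧
      ∀ v w : NZ, (w : E3) = -v → c w = - c v := by
  have hM : 0 < μ.real Set.univ := real_pos μ isOpen_univ ⟨0, trivial⟩
  have hcont : ∀ {Y : Type} [TopologicalSpace Y] [FirstCountableTopology Y] (p : Y → E3 × ℝ),
      Continuous p → (∀ y, (p y).1 ≠ 0) → Continuous fun y => mP μ (p y) := by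
    intro Y _ _ p hp hp0
    have := cont_mR μ hn p p p hp hp hp hp0 hp0 hp0
    simpa [mR_self, mQ_self] using this
  have hex : ∀ v : NZ, ∃ c, mP μ (v, c) = μ.real Set.univ / 2 := by
    intro v
    have h1 : Filter.Tendsto (fun c : ℝ => mP μ (v, c)) Filter.atTop (nhds 0) := by
      have : Filter.Tendsto (fun c : ℝ => μ (hsp (v, c))) Filter.atTop (nhds (μ ∅)) := by
        apply tendsto_measure_of_ae_tendsto_indicator_of_isFiniteMeasure
        · exact MeasurableSet.empty
        · exact fun c => hsp_meas _
        · refine Filter.Eventually.of_forall fun x => ?_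
          filter_upwards [Filter.eventually_gt_atTop ⟪(v : E3), x⟫] with c hc
          simp only [mem_hsp, Set.mem_empty_iff_false, iff_false, not_lt]
          exact hc.le
      have h2 := (ENNReal.tendsto_toReal (measure_ne_top μ _)).comp this
      rw [measure_empty] at h2
      exact h2
    have h2 : Filter.Tendsto (fun c : ℝ => mP μ (v, c)) Filter.atBot (nhds (μ.real Set.univ)) := by
      have : Filter.Tendsto (fun c : ℝ => μ (hsp (v, c))) Filter.atBot (nhds (μ Set.univ)) := by
        apply tendsto_measure_of_ae_tendsto_indicator_of_isFiniteMeasure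
        · exact MeasurableSet.univ
        · exact fun c => hsp_meas _
        · refine Filter.Eventually.of_forall fun x => ?_
          filter_upwards [Filter.eventually_lt_atBot ⟪(v : E3), x⟫] with c hc
          simpa [mem_hsp] using hc
      exact (ENNReal.tendsto_toReal (measure_ne_top μ _)).comp this
    obtain ⟨a, ha⟩ := (h1.eventually_lt_const (half_pos hM)).exists
    obtain ⟨b, hb⟩ := (h2.eventually_const_lt (half_lt_self hM)).exists
    exact mem_range_of_exists_le_of_exists_ge
      (hcont (fun c : ℝ => ((v : E3), c)) (by fun_prop) (fun _ => v.2)) ⟨a, ha.le⟩ ⟨b, hb.le⟩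
  choose c hc using hex
  refine ⟨c, ?_, hc, ?_⟩
  · refine implicit_cont (fun (v : NZ) y => mP μ (v, y)) Set.univ isOpen_univ ?_ ?_ _ c
      (fun _ => trivial) hc
    · exact fun y _ => hcont (fun v : NZ => ((v : E3), y)) (by fun_prop) (fun v => v.2)
    · exact fun v => (mP_anti μ v v.2).strictAntiOn _
  · intro v w hw
    apply (mP_anti μ w w.2).injective
    have h1 := split_P μ hn (v, c v) v.2
    have e : -((v : E3), c v) = ((w : E3), - c v) := by rw [hw]; rfl
    rw [e, hc v] at h1
    simp only
    rw [hc w]; linarith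

/-! ### Geometry of the planar family -/

lemma half_neg (μ : Measure E3) [IsFiniteMeasure μ] (hn : PlaneNull μ) {p : E3 × ℝ}
    (hp : p.1 ≠ 0) (h : mP μ p = μ.real Set.univ / 2) : mP μ (-p) = μ.real Set.univ / 2 := by
  have := split_P μ hn p hp
  linarith

lemma mQ_neg_neg (μ : Measure E3) [IsFiniteMeasure μ] (hn : PlaneNull μ) {p q : E3 × ℝ}
    (hp : p.1 ≠ 0) (hq : q.1 ≠ 0) (h1 : mP μ p = μ.real Set.univ / 2)
    (h2 : mP μ q = μ.real Set.univ / 2) : mQ μ (-p) (-q) = mQ μ p q := by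
  have a1 := split_Q μ hn p q hq
  have a2 := split_Q μ hn (-q) p hp
  have a3 := half_neg μ hn hq h2
  rw [mQ_comm μ (-q) p, mQ_comm μ (-q) (-p)] at a2
  linarith

lemma anti_case (μ : Measure E3) [IsFiniteMeasure μ] [μ.IsOpenPosMeasure]
    {p1 p2 p3 : E3 × ℝ} {s t : ℝ} (hs : 0 < s) (ht : 0 < t) (h2 : p2.1 = s • p1.1 + t • p3.1)
    (hsol : ∀ α β : ℝ, ∃ x, ⟪p1.1, x⟫ = α ∧ ⟪p3.1, x⟫ = β)
    (hle : p2.2 ≤ s * p1.2 + t * p3.2) : mQ μ p1 p3 < mQ μ p1 p2 := by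
  have hin : ∀ x, ⟪p2.1, x⟫ = s * ⟪p1.1, x⟫ + t * ⟪p3.1, x⟫ := by
    intro x; rw [h2, inner_add_left, inner_smul_left, inner_smul_left]; simp
  apply real_lt μ (C := hsp p1 ∩ hsp p2 ∩ hsp (-p3))
  · intro x hx
    refine ⟨hx.1, ?_⟩
    have a1 := hx.1
    have a2 := hx.2
    rw [mem_hsp] at a1 a2 ⊢
    rw [hin]
    nlinarith
  · exact ((isOpen_hsp _).inter (isOpen_hsp _)).inter (isOpen_hsp _)
  · obtain ⟨x, h1, h3⟩ := hsol (max (p1.2 + 1) ((p2.2 - t * (p3.2 - 1)) / s + 1)) (p3.2 - 1)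
    refine ⟨x, ⟨?_, ?_⟩, ?_⟩
    · rw [mem_hsp, h1]
      exact lt_of_lt_of_le (lt_add_one _) (le_max_left _ _)
    · rw [mem_hsp, hin, h1, h3]
      have : s * ((p2.2 - t * (p3.2 - 1)) / s + 1)
          ≤ s * max (p1.2 + 1) ((p2.2 - t * (p3.2 - 1)) / s + 1) := by
        gcongr; exact le_max_right _ _
      rw [mul_add, mul_div_cancel₀ _ hs.ne'] at this
      linarith
    · rw [mem_hsp_neg, h3]; linarith
  · exact fun x hx => hx.1
  · rw [Set.disjoint_left]
    intro x hx h4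
    have a := hx.2
    have b := h4.2
    rw [mem_hsp] at a
    rw [mem_hsp_neg] at b
    linarith

lemma sol_neg_left {a b : E3} (h : ∀ α β : ℝ, ∃ x : E3, ⟪a, x⟫ = α ∧ ⟪b, x⟫ = β) :
    ∀ α β : ℝ, ∃ x : E3, ⟪-a, x⟫ = α ∧ ⟪b, x⟫ = β := by
  intro α β
  obtain ⟨x, h1, h2⟩ := h (-α) β
  exact ⟨x, by rw [inner_neg_left, h1, neg_neg], h2⟩

lemma sol_neg_right {a b : E3} (h : ∀ α β : ℝ, ∃ x : E3, ⟪a, x⟫ = α ∧ ⟪b, x⟫ = β) :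
    ∀ α β : ℝ, ∃ x : E3, ⟪a, x⟫ = α ∧ ⟪-b, x⟫ = β := by
  intro α β
  obtain ⟨x, h1, h2⟩ := h α (-β)
  exact ⟨x, h1, by rw [inner_neg_left, h2, neg_neg]⟩

lemma anti_abs (μ : Measure E3) [IsFiniteMeasure μ] (hn : PlaneNull μ) [μ.IsOpenPosMeasure]
    {p1 p2 p3 : E3 × ℝ} {s t : ℝ} (hs : 0 < s) (ht : 0 < t) (h2 : p2.1 = s • p1.1 + t • p3.1)
    (hsol : ∀ α β : ℝ, ∃ x, ⟪p1.1, x⟫ = α ∧ ⟪p3.1, x⟫ = β)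
    (n1 : p1.1 ≠ 0) (n2 : p2.1 ≠ 0) (n3 : p3.1 ≠ 0)
    (m1 : mP μ p1 = μ.real Set.univ / 2) (m2 : mP μ p2 = μ.real Set.univ / 2)
    (m3 : mP μ p3 = μ.real Set.univ / 2) : mQ μ p1 p3 < mQ μ p1 p2 := by
  rcases le_total p2.2 (s * p1.2 + t * p3.2) with hle | hle
  · exact anti_case μ hs ht h2 hsol hle
  · rw [← mQ_neg_neg μ hn n1 n3 m1 m3, ← mQ_neg_neg μ hn n1 n2 m1 m2]
    refine anti_case μ hs ht ?_ (sol_neg_left (sol_neg_right hsol)) ?_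
    · simp only [Prod.fst_neg, h2]; module
    · simp only [Prod.snd_neg]; linarith

def fd (μ : Measure E3) (p q r : E3 × ℝ) : ℝ := mR μ p q r - mR μ p q (-r)

lemma eq_case (μ : Measure E3) [IsFiniteMeasure μ] (hn : PlaneNull μ) [μ.IsOpenPosMeasure]
    {p q r : E3 × ℝ} {s t : ℝ} (hs : 0 ≤ s) (ht : 0 ≤ t) (h2 : r.1 = s • p.1 + t • q.1)
    (hsol : ∀ α β : ℝ, ∃ x, ⟪p.1, x⟫ = α ∧ ⟪q.1, x⟫ = β)
    (hr : r.1 ≠ 0) (hQ : mQ μ (-p) (-q) = mQ μ p q)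
    (hle : r.2 ≤ s * p.2 + t * q.2) : fd μ p q r ≠ fd μ (-p) (-q) r := by
  have hin : ∀ x, ⟪r.1, x⟫ = s * ⟪p.1, x⟫ + t * ⟪q.1, x⟫ := by
    intro x; rw [h2, inner_add_left, inner_smul_left, inner_smul_left]; simp
  have hst : 0 < s + t := by
    rcases hs.lt_or_eq with h | h
    · linarith
    · rcases ht.lt_or_eq with h' | h'
      · linarith
      · exact absurd (by rw [h2, ← h, ← h']; simp) hr
  have b0 : mR μ p q (-r) = 0 := by
    have : hsp p ∩ hsp q ∩ hsp (-r) = ∅ := by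
      ext x
      simp only [Set.mem_inter_iff, Set.mem_empty_iff_false, iff_false, mem_hsp_neg]
      rintro ⟨⟨a1, a2⟩, a3⟩
      rw [mem_hsp] at a1 a2
      rw [hin] at a3
      nlinarith
    simp [mR, this]
  have b1 : 0 < mR μ (-p) (-q) (-r) := by
    apply real_pos μ (((isOpen_hsp _).inter (isOpen_hsp _)).inter (isOpen_hsp _))
    set K := |p.2| + |q.2| + |r.2| / (s + t) + 1 with hK
    obtain ⟨x, h1, h3⟩ := hsol (-K) (-K)
    have k1 := neg_abs_le p.2
    have k2 := neg_abs_le q.2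
    have k3 := neg_abs_le r.2
    have k4 : 0 ≤ |r.2| / (s + t) := by positivity
    have k5 := abs_nonneg p.2
    have k6 := abs_nonneg q.2
    refine ⟨x, ⟨?_, ?_⟩, ?_⟩
    · rw [mem_hsp_neg, h1]; linarith
    · rw [mem_hsp_neg, h3]; linarith
    · rw [mem_hsp_neg, hin, h1, h3]
      have : (s + t) * K = (s + t) * (|p.2| + |q.2| + 1) + |r.2| := by
        rw [hK]; field_simp; ring
      have : 0 < (s + t) * (|p.2| + |q.2| + 1) := by positivity
      linarith
  have c1 := split_R μ hn p q r hr
  have c2 := split_R μ hn (-p) (-q) r hr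
  intro h
  unfold fd at h
  linarith

lemma eq_abs (μ : Measure E3) [IsFiniteMeasure μ] (hn : PlaneNull μ) [μ.IsOpenPosMeasure]
    {p q r : E3 × ℝ} {s t : ℝ} (hs : 0 ≤ s) (ht : 0 ≤ t) (h2 : r.1 = s • p.1 + t • q.1)
    (hsol : ∀ α β : ℝ, ∃ x, ⟪p.1, x⟫ = α ∧ ⟪q.1, x⟫ = β)
    (hr : r.1 ≠ 0) (hQ : mQ μ (-p) (-q) = mQ μ p q) : fd μ p q r ≠ fd μ (-p) (-q) r := by
  rcases le_total r.2 (s * p.2 + t * q.2) with hle | hle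
  · exact eq_case μ hn hs ht h2 hsol hr hQ hle
  · have := eq_case μ hn (p := -p) (q := -q) (r := -r) hs ht
      (by simp only [Prod.fst_neg, h2]; module) (sol_neg_left (sol_neg_right hsol))
      (neg_fst_ne hr) (by rw [neg_neg, neg_neg, hQ])
      (by simp only [Prod.snd_neg]; linarith)
    intro h
    apply this
    unfold fd at h ⊢
    simp only [neg_neg]
    linarith

lemma eq_final (μ : Measure E3) [IsFiniteMeasure μ] (hn : PlaneNull μ) [μ.IsOpenPosMeasure]
    {p q r : E3 × ℝ} {s t : ℝ} (h2 : r.1 = s • p.1 + t • q.1)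
    (hsol : ∀ α β : ℝ, ∃ x, ⟪p.1, x⟫ = α ∧ ⟪q.1, x⟫ = β)
    (hp : p.1 ≠ 0) (hq : q.1 ≠ 0) (hr : r.1 ≠ 0)
    (m1 : mP μ p = μ.real Set.univ / 2) (m2 : mP μ q = μ.real Set.univ / 2)
    (e1 : fd μ p q r = fd μ (-p) (-q) r) (e2 : fd μ (-p) q r = fd μ p (-q) r) : False := by
  have hQ := mQ_neg_neg μ hn hp hq m1 m2
  have hQ' := mQ_neg_neg μ hn hp (neg_fst_ne hq) m1 (half_neg μ hn hq m2)
  rw [neg_neg] at hQ'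
  rcases le_total 0 s with hs | hs <;> rcases le_total 0 t with ht | ht
  · exact eq_abs μ hn hs ht h2 hsol hr hQ e1
  · refine eq_abs μ hn (p := p) (q := -q) hs (neg_nonneg.mpr ht) ?_ (sol_neg_right hsol) hr ?_ ?_
    · rw [h2, Prod.fst_neg]; module
    · rw [neg_neg]; exact hQ'
    · rw [neg_neg]; exact e2.symm
  · refine eq_abs μ hn (p := -p) (q := q) (neg_nonneg.mpr hs) ht ?_ (sol_neg_left hsol) hr ?_ ?_
    · rw [h2, Prod.fst_neg]; module
    · rw [neg_neg]; exact hQ'.symm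
    · rw [neg_neg]; exact e2
  · refine eq_abs μ hn (p := -p) (q := -q) (neg_nonneg.mpr hs) (neg_nonneg.mpr ht) ?_
      (sol_neg_left (sol_neg_right hsol)) hr ?_ ?_
    · rw [h2, Prod.fst_neg, Prod.fst_neg]; module
    · rw [neg_neg, neg_neg]; exact hQ.symm
    · rw [neg_neg, neg_neg]; exact e1.symm

def nn (e1 e2 : E3) (θ : ℝ) : E3 := Real.cos θ • e1 + Real.sin θ • e2

lemma nn_rel (e1 e2 : E3) (a b c : ℝ) : Real.sin (b - a) • nn e1 e2 c =
    Real.sin (b - c) • nn e1 e2 a + Real.sin (c - a) • nn e1 e2 b := by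
  unfold nn
  have h1 : Real.sin (b - a) * Real.cos c = Real.sin (b - c) * Real.cos a
      + Real.sin (c - a) * Real.cos b := by
    simp only [Real.sin_sub]; ring
  have h2 : Real.sin (b - a) * Real.sin c = Real.sin (b - c) * Real.sin a
      + Real.sin (c - a) * Real.sin b := by
    simp only [Real.sin_sub]; ring
  rw [smul_add, smul_smul, smul_smul, h1, h2]
  module

lemma nn_rel' (e1 e2 : E3) (a b c : ℝ) (h : Real.sin (b - a) ≠ 0) : nn e1 e2 c =
    (Real.sin (b - c) / Real.sin (b - a)) • nn e1 e2 a
      + (Real.sin (c - a) / Real.sin (b - a)) • nn e1 e2 b := by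
  have := nn_rel e1 e2 a b c
  rw [← inv_smul_smul₀ h (nn e1 e2 c), this, smul_add, smul_smul, smul_smul]
  congr 2 <;> ring

lemma nn_inner (e1 e2 : E3) (h1 : ⟪e1, e1⟫ = 1) (h2 : ⟪e2, e2⟫ = 1) (h12 : ⟪e1, e2⟫ = 0)
    (θ X Y : ℝ) : ⟪nn e1 e2 θ, X • e1 + Y • e2⟫ = X * Real.cos θ + Y * Real.sin θ := by
  have h21 : ⟪e2, e1⟫ = 0 := by rw [real_inner_comm]; exact h12
  simp only [nn, inner_add_left, inner_add_right, inner_smul_left, inner_smul_right, h1, h2, h12,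
    h21]
  simp

lemma nn_ne (e1 e2 : E3) (h1 : ⟪e1, e1⟫ = 1) (h2 : ⟪e2, e2⟫ = 1) (h12 : ⟪e1, e2⟫ = 0)
    (θ : ℝ) : nn e1 e2 θ ≠ 0 := by
  intro h
  have := nn_inner e1 e2 h1 h2 h12 θ (Real.cos θ) (Real.sin θ)
  rw [h, inner_zero_left] at this
  nlinarith [Real.sin_sq_add_cos_sq θ]

lemma nn_solve (e1 e2 : E3) (h1 : ⟪e1, e1⟫ = 1) (h2 : ⟪e2, e2⟫ = 1) (h12 : ⟪e1, e2⟫ = 0)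
    (a b : ℝ) (h : Real.sin (b - a) ≠ 0) (α β : ℝ) :
    ∃ x, ⟪nn e1 e2 a, x⟫ = α ∧ ⟪nn e1 e2 b, x⟫ = β := by
  refine ⟨((α * Real.sin b - β * Real.sin a) / Real.sin (b - a)) • e1
    + ((β * Real.cos a - α * Real.cos b) / Real.sin (b - a)) • e2, ?_, ?_⟩
  · rw [nn_inner e1 e2 h1 h2 h12]
    field_simp
    rw [Real.sin_sub]; ring
  · rw [nn_inner e1 e2 h1 h2 h12]
    field_simp
    rw [Real.sin_sub]; ring

lemma exists_T (μ : Measure E3) [IsFiniteMeasure μ] (hn : PlaneNull μ) [μ.IsOpenPosMeasure]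
    (e1 e2 : E3) (h1 : ⟪e1, e1⟫ = 1) (h2 : ⟪e2, e2⟫ = 1) (h12 : ⟪e1, e2⟫ = 0)
    (l : ℝ → E3 × ℝ) (hlc : Continuous l) (hl : ∀ θ, (l θ).1 = nn e1 e2 θ)
    (hm : ∀ θ, mP μ (l θ) = μ.real Set.univ / 2) (hpi : ∀ θ, l (θ + Real.pi) = - l θ) :
    ∃ T : ℝ → ℝ, Continuous T ∧ (∀ θ, 0 < Real.sin (T θ - θ)) ∧
      (∀ θ, mQ μ (l θ) (l (T θ)) = μ.real Set.univ / 4) ∧ T (T 0) = Real.pi := by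
  have hM : 0 < μ.real Set.univ := real_pos μ isOpen_univ ⟨0, trivial⟩
  have hl0 : ∀ θ, (l θ).1 ≠ 0 := fun θ => by rw [hl]; exact nn_ne e1 e2 h1 h2 h12 θ
  have hF : Continuous fun p : ℝ × ℝ => mQ μ (l p.1) (l (p.1 + p.2)) := by
    have := cont_mR μ hn (fun p : ℝ × ℝ => l p.1) (fun p : ℝ × ℝ => l (p.1 + p.2))
      (fun p : ℝ × ℝ => l (p.1 + p.2)) (by fun_prop) (by fun_prop) (by fun_prop)
      (fun _ => hl0 _) (fun _ => hl0 _) (fun _ => hl0 _)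
    simpa only [mR_self] using this
  have hanti : ∀ θ, StrictAntiOn (fun y => mQ μ (l θ) (l (θ + y))) (Set.Ioo 0 Real.pi) := by
    intro θ a ha b hb hab
    have s1 : 0 < Real.sin (b - a) := Real.sin_pos_of_pos_of_lt_pi (by linarith)
      (by linarith [ha.1, hb.2])
    have s2 : 0 < Real.sin a := Real.sin_pos_of_pos_of_lt_pi ha.1 ha.2
    have s3 : 0 < Real.sin b := Real.sin_pos_of_pos_of_lt_pi hb.1 hb.2
    have q1 : θ + b - θ = b := by ring
    have q2 : θ + a - θ = a := by ring
    have q3 : θ + b - (θ + a) = b - a := by ring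
    have rel := nn_rel' e1 e2 θ (θ + b) (θ + a) (by rw [q1]; exact s3.ne')
    rw [q1, q2, q3] at rel
    refine anti_abs μ hn (div_pos s1 s3) (div_pos s2 s3) ?_ ?_ (hl0 _) (hl0 _) (hl0 _)
      (hm _) (hm _) (hm _)
    · rw [hl, hl, hl]; exact rel
    · rw [hl, hl]
      exact nn_solve e1 e2 h1 h2 h12 _ _ (by rw [q1]; exact s3.ne')
  have hex : ∀ θ, ∃ y ∈ Set.Ioo 0 Real.pi, mQ μ (l θ) (l (θ + y)) = μ.real Set.univ / 4 := by
    intro θ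
    have f0 : mQ μ (l θ) (l (θ + 0)) = μ.real Set.univ / 2 := by
      rw [add_zero, mQ_self, hm]
    have f1 : mQ μ (l θ) (l (θ + Real.pi)) = 0 := by
      have := split_Q μ hn (l θ) (l θ) (hl0 θ)
      rw [mQ_self] at this
      rw [hpi]; linarith
    have hc : Continuous fun y => mQ μ (l θ) (l (θ + y)) :=
      hF.comp (by fun_prop : Continuous fun y : ℝ => (θ, y))
    obtain ⟨y, hy, hyv⟩ := intermediate_value_Icc' Real.pi_pos.le hc.continuousOn
      (show μ.real Set.univ / 4 ∈ _ by rw [Set.mem_Icc, f0, f1]; constructor <;> linarith)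
    refine ⟨y, ⟨lt_of_le_of_ne hy.1 ?_, lt_of_le_of_ne hy.2 ?_⟩, hyv⟩
    · rintro rfl; simp only at hyv; rw [f0] at hyv; linarith
    · rintro rfl; simp only at hyv; rw [f1] at hyv; linarith
  choose y hy hyv using hex
  have hyc : Continuous y := implicit_cont (fun θ y => mQ μ (l θ) (l (θ + y))) _ isOpen_Ioo
    (fun y _ => hF.comp (by fun_prop : Continuous fun θ : ℝ => (θ, y))) hanti _ y hy hyv
  refine ⟨fun θ => θ + y θ, by fun_prop, fun θ => ?_, hyv, ?_⟩
  · rw [add_sub_cancel_left]; exact Real.sin_pos_of_pos_of_lt_pi (hy θ).1 (hy θ).2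
  · simp only [zero_add]
    have hyy : Real.pi - y 0 ∈ Set.Ioo 0 Real.pi := ⟨by linarith [(hy 0).2], by linarith [(hy 0).1]⟩
    have : y (y 0) = Real.pi - y 0 := by
      apply (hanti (y 0)).injOn (hy _) hyy
      simp only
      rw [hyv, add_sub_cancel, ← zero_add Real.pi, hpi]
      have a := split_Q μ hn (l (y 0)) (l 0) (hl0 _)
      have b := hyv 0
      rw [zero_add, mQ_comm] at b
      rw [hm] at a
      linarith
    rw [this]; ring

/-! ### Measures with full support -/

lemma split_R2 (μ : Measure E3) [IsFiniteMeasure μ] (hn : PlaneNull μ) (p q r : E3 × ℝ)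
    (hq : q.1 ≠ 0) : mR μ p q r + mR μ p (-q) r = mQ μ p r := by
  have := split_real μ hn (hsp p ∩ hsp r) q hq
  rw [Set.inter_right_comm, Set.inter_right_comm (hsp p) (hsp r) (hsp (-q))] at this
  exact this

lemma full_support (μ : Measure E3) [IsFiniteMeasure μ] (hn : PlaneNull μ) [μ.IsOpenPosMeasure]
    (u e1 e2 : E3) (hu : ⟪u, u⟫ = 1) (h1 : ⟪e1, e1⟫ = 1) (h2 : ⟪e2, e2⟫ = 1) (h12 : ⟪e1, e2⟫ = 0)
    (h1u : ⟪e1, u⟫ = 0) (h2u : ⟪e2, u⟫ = 0) :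
    ∃ p q r : E3 × ℝ, p.1 ≠ 0 ∧ q.1 ≠ 0 ∧ r.1 ≠ 0 ∧ ⟪p.1, u⟫ = 0 ∧ ⟪q.1, u⟫ = 0 ∧
      mR μ p q r = μ.real Set.univ / 8 ∧ mR μ p q (-r) = μ.real Set.univ / 8 ∧
      mR μ p (-q) r = μ.real Set.univ / 8 ∧ mR μ p (-q) (-r) = μ.real Set.univ / 8 ∧
      mR μ (-p) q r = μ.real Set.univ / 8 ∧ mR μ (-p) q (-r) = μ.real Set.univ / 8 ∧
      mR μ (-p) (-q) r = μ.real Set.univ / 8 ∧ mR μ (-p) (-q) (-r) = μ.real Set.univ / 8 := by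
  obtain ⟨c, hc, hcm, hcn⟩ := exists_med μ hn
  -- planes orthogonal to the base plane
  set N : ℝ → NZ := fun θ => ⟨nn e1 e2 θ, nn_ne e1 e2 h1 h2 h12 θ⟩ with hN
  have hNc : Continuous N := by
    apply Continuous.subtype_mk
    unfold nn
    fun_prop
  set l : ℝ → E3 × ℝ := fun θ => ((N θ : E3), c (N θ)) with hl
  have hlc : Continuous l := by fun_prop
  have hl1 : ∀ θ, (l θ).1 = nn e1 e2 θ := fun θ => rfl
  have hl0 : ∀ θ, (l θ).1 ≠ 0 := fun θ => (N θ).2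
  have hlm : ∀ θ, mP μ (l θ) = μ.real Set.univ / 2 := fun θ => hcm _
  have hlpi : ∀ θ, l (θ + Real.pi) = - l θ := by
    intro θ
    have e : ((N (θ + Real.pi)) : E3) = -(N θ : E3) := by
      simp only [hN, nn, Real.cos_add_pi, Real.sin_add_pi]
      module
    have e' := hcn _ _ e
    simp only [hl, e, e']
    rfl
  obtain ⟨T, hT, hTs, hTQ, hTT⟩ := exists_T μ hn e1 e2 h1 h2 h12 l hlc hl1 hlm hlpi
  -- third plane
  have hVne : ∀ ζ : ℂ, ζ.re • e1 + ζ.im • e2 + (1 - ‖ζ‖) • u ≠ 0 := by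
    intro ζ h0
    have h21 : ⟪e2, e1⟫ = 0 := by rw [real_inner_comm]; exact h12
    have hu1 : ⟪u, e1⟫ = 0 := by rw [real_inner_comm]; exact h1u
    have hu2 : ⟪u, e2⟫ = 0 := by rw [real_inner_comm]; exact h2u
    have a1 := congrArg (fun x => ⟪x, e1⟫) h0
    have a2 := congrArg (fun x => ⟪x, e2⟫) h0
    have a3 := congrArg (fun x => ⟪x, u⟫) h0
    simp only [inner_add_left, inner_smul_left, inner_zero_left, h1, h2, h12, h21, h1u, h2u, hu1,
      hu2, hu] at a1 a2 a3
    simp at a1 a2 a3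
    have : ζ = 0 := Complex.ext a1 a2
    simp [this] at a3
  set V : ℂ → NZ := fun ζ => ⟨_, hVne ζ⟩ with hV
  have hVc : Continuous V := by
    apply Continuous.subtype_mk
    fun_prop
  set m : ℂ → E3 × ℝ := fun ζ => ((V ζ : E3), c (V ζ)) with hm
  have hmc : Continuous m := by fun_prop
  have hm0 : ∀ ζ, (m ζ).1 ≠ 0 := fun ζ => (V ζ).2
  have hmm : ∀ ζ, mP μ (m ζ) = μ.real Set.univ / 2 := fun ζ => hcm _
  have hmn : ∀ ζ, ‖ζ‖ = 1 → m (-ζ) = - m ζ := by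
    intro ζ hζ
    have e : (V (-ζ) : E3) = -(V ζ : E3) := by
      simp only [hV, Complex.neg_re, Complex.neg_im, norm_neg, hζ]
      module
    have e' := hcn _ _ e
    simp only [hm, e, e']
    rfl
  have hmarg : ∀ ζ, ‖ζ‖ = 1 → (m ζ).1 = nn e1 e2 ζ.arg := by
    intro ζ hζ
    have hz : ζ ≠ 0 := by intro h; simp [h] at hζ
    simp only [hm, hV, nn, Complex.cos_arg hz, Complex.sin_arg, hζ]
    simp
  set p : ℝ × ℂ → E3 × ℝ := fun x => l (x.1 * T 0) with hp
  set q : ℝ × ℂ → E3 × ℝ := fun x => l (T (x.1 * T 0)) with hq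
  set r : ℝ × ℂ → E3 × ℝ := fun x => m x.2 with hr
  have pc : Continuous p := by fun_prop
  have qc : Continuous q := by fun_prop
  have rc : Continuous r := by fun_prop
  have p0 : ∀ x, (p x).1 ≠ 0 := fun x => hl0 _
  have q0 : ∀ x, (q x).1 ≠ 0 := fun x => hl0 _
  have r0 : ∀ x, (r x).1 ≠ 0 := fun x => hm0 _
  have fc : ∀ a b : ℝ × ℂ → E3 × ℝ, Continuous a → Continuous b → (∀ x, (a x).1 ≠ 0) →
      (∀ x, (b x).1 ≠ 0) → Continuous fun x => fd μ (a x) (b x) (r x) := by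
    intro a b ha hb ha0 hb0
    exact (cont_mR μ hn a b r ha hb rc ha0 hb0 r0).sub
      (cont_mR μ hn a b (fun x => - r x) ha hb rc.neg ha0 hb0 (fun x => neg_fst_ne (r0 x)))
  have f1c := fc p q pc qc p0 q0
  have f2c := fc (fun x => - p x) q pc.neg qc (fun x => neg_fst_ne (p0 x)) q0
  have f3c := fc (fun x => - p x) (fun x => - q x) pc.neg qc.neg (fun x => neg_fst_ne (p0 x))
    (fun x => neg_fst_ne (q0 x))
  have f4c := fc p (fun x => - q x) pc qc.neg p0 (fun x => neg_fst_ne (q0 x))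
  have hend : ∀ ζ, p (1, ζ) = q (0, ζ) ∧ q (1, ζ) = - p (0, ζ) ∧ r (1, ζ) = r (0, ζ) := by
    intro ζ
    refine ⟨?_, ?_, rfl⟩
    · simp [hp, hq]
    · simp only [hp, hq, one_mul, zero_mul, hTT]
      rw [← hlpi, zero_add]
  have fcomm : ∀ a b d, fd μ a b d = fd μ b a d := by
    intro a b d
    simp only [fd, mR_comm μ a b]
  obtain ⟨x, hx1, hx2⟩ := top_lemma
    (fun x => ((fd μ (p x) (q x) (r x) - fd μ (-p x) (-q x) (r x) : ℝ) : ℂ)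
      + ((fd μ (-p x) (q x) (r x) - fd μ (p x) (-q x) (r x) : ℝ) : ℂ) * Complex.I)
    (fun x => fd μ (p x) (q x) (r x) - fd μ (-p x) (q x) (r x) + fd μ (-p x) (-q x) (r x)
      - fd μ (p x) (-q x) (r x)) (by fun_prop) (by fun_prop)
    (by
      intro t ζ hζ h0
      rw [Complex.ext_iff] at h0
      simp at h0
      have hs := hTs (t * T 0)
      refine eq_final μ hn
        (s := Real.sin (T (t * T 0) - ζ.arg) / Real.sin (T (t * T 0) - (t * T 0)))
        (t := Real.sin (ζ.arg - (t * T 0)) / Real.sin (T (t * T 0) - (t * T 0)))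
        (p := p (t, ζ)) (q := q (t, ζ)) (r := r (t, ζ)) ?_ ?_ (p0 _) (q0 _) (r0 _)
        (hlm _) (hlm _) (sub_eq_zero.mp h0.1) (sub_eq_zero.mp h0.2)
      · simp only [hr, hmarg ζ hζ]
        exact nn_rel' e1 e2 _ _ _ hs.ne'
      · exact nn_solve e1 e2 h1 h2 h12 _ _ hs.ne')
    (by
      intro t ζ hζ
      have e : r (t, -ζ) = - r (t, ζ) := hmn ζ hζ
      have e1 : p (t, -ζ) = p (t, ζ) := rfl
      have e2 : q (t, -ζ) = q (t, ζ) := rfl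
      simp only [e, e1, e2, fd, neg_neg]
      push_cast
      ring)
    (by
      intro ζ
      obtain ⟨a1, a2, a3⟩ := hend ζ
      simp only [a1, a2, a3, neg_neg]
      rw [fcomm (q (0, ζ)), fcomm (-q (0, ζ)), fcomm (-q (0, ζ)), fcomm (q (0, ζ)) (p (0, ζ))]
      push_cast
      linear_combination ((fd μ (-p (0, ζ)) (q (0, ζ)) (r (0, ζ)) : ℂ)
        - fd μ (p (0, ζ)) (-q (0, ζ)) (r (0, ζ))) * Complex.I_sq)
    (by
      intro ζ
      obtain ⟨a1, a2, a3⟩ := hend ζ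
      simp only [a1, a2, a3, neg_neg]
      rw [fcomm (q (0, ζ)), fcomm (-q (0, ζ)), fcomm (-q (0, ζ)), fcomm (q (0, ζ)) (p (0, ζ))]
      ring)
  rw [Complex.ext_iff] at hx1
  simp at hx1
  obtain ⟨y1, y2⟩ := hx1
  have iu : ∀ θ, ⟪(l θ).1, u⟫ = 0 := by
    intro θ
    rw [hl1, nn, inner_add_left, inner_smul_left, inner_smul_left, h1u, h2u]
    simp
  have mp : mP μ (p x) = μ.real Set.univ / 2 := hlm _
  have mq : mP μ (q x) = μ.real Set.univ / 2 := hlm _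
  have mr : mP μ (r x) = μ.real Set.univ / 2 := hmm _
  have mpq : mQ μ (p x) (q x) = μ.real Set.univ / 4 := hTQ _
  have hpx := p0 x
  have hqx := q0 x
  have hrx := r0 x
  have ipx : ⟪(p x).1, u⟫ = 0 := iu _
  have iqx : ⟪(q x).1, u⟫ = 0 := iu _
  generalize p x = P at *
  generalize q x = Q at *
  generalize r x = R at *
  have mr' := half_neg μ hn hrx mr
  have k1 := mQ_neg_neg μ hn hpx hqx mp mq
  have k2 := split_Q μ hn P Q hqx
  have k3 := split_Q μ hn Q P hpx
  rw [mQ_comm μ Q P, mQ_comm μ Q (-P)] at k3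
  have s1 := split_R μ hn P Q R hrx
  have s2 := split_R μ hn (-P) Q R hrx
  have s3 := split_R μ hn (-P) (-Q) R hrx
  have s4 := split_R μ hn P (-Q) R hrx
  have t1 := split_R2 μ hn P Q R hqx
  have t2 := split_R2 μ hn (-P) Q R hqx
  have t3 := split_Q μ hn R P hpx
  rw [mQ_comm μ R P, mQ_comm μ R (-P)] at t3
  unfold fd at hx2 y1 y2
  refine ⟨P, Q, R, hpx, hqx, hrx, ipx, iqx, ?_, ?_, ?_, ?_, ?_, ?_, ?_, ?_⟩ <;> linarith

/-! ### The limit argument -/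

/-- the plane `p`, with orientation reversed if the sign is negative -/
def sg (s : Bool) (p : E3 × ℝ) : E3 × ℝ := if s then p else -p

lemma orthant_eq (v : Fin 3 → E3) (a : Fin 3 → ℝ) (α : Fin 3 → Bool) :
    orthant v a α = ⋂ i, hsp (sg (α i) (v i, a i)) := by
  unfold orthant
  refine Set.iInter_congr fun i => ?_
  cases h : α i
  · ext x
    simp [halfSpace, sg, hsp, inner_neg_left]
  · ext x
    simp [halfSpace, sg, hsp]

lemma hsp_smul {c : ℝ} (hc : 0 < c) (p : E3 × ℝ) : hsp (c • p) = hsp p := by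
  ext x
  simp [hsp, inner_smul_left, hc]

lemma sg_smul (s : Bool) (c : ℝ) (p : E3 × ℝ) : sg s (c • p) = c • sg s p := by
  cases s <;> simp [sg]

lemma continuous_sg (s : Bool) : Continuous (sg s) := by
  cases s
  · exact continuous_neg
  · exact continuous_id

lemma sg_fst_ne (s : Bool) {p : E3 × ℝ} (hp : p.1 ≠ 0) : (sg s p).1 ≠ 0 := by
  cases s
  · simpa [sg] using hp
  · simpa [sg] using hp

lemma full_support_norm (μ : Measure E3) [IsFiniteMeasure μ] (hn : PlaneNull μ)
    [μ.IsOpenPosMeasure] (u e1 e2 : E3) (hu : ⟪u, u⟫ = 1) (h1 : ⟪e1, e1⟫ = 1) (h2 : ⟪e2, e2⟫ = 1)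
    (h12 : ⟪e1, e2⟫ = 0) (h1u : ⟪e1, u⟫ = 0) (h2u : ⟪e2, u⟫ = 0) :
    ∃ P : Fin 3 → E3 × ℝ, (∀ i, ‖(P i).1‖ = 1) ∧ ⟪(P 0).1, u⟫ = 0 ∧ ⟪(P 1).1, u⟫ = 0 ∧
      ∀ α : Fin 3 → Bool, μ.real (⋂ i, hsp (sg (α i) (P i))) = μ.real Set.univ / 8 := by
  obtain ⟨p, q, r, hp, hq, hr, hpu, hqu, m1, m2, m3, m4, m5, m6, m7, m8⟩ :=
    full_support μ hn u e1 e2 hu h1 h2 h12 h1u h2u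
  have hne : ∀ i, ((![p, q, r] : Fin 3 → E3 × ℝ) i).1 ≠ 0 := by
    intro i
    fin_cases i
    · exact hp
    · exact hq
    · exact hr
  refine ⟨fun i => ‖((![p, q, r] : Fin 3 → E3 × ℝ) i).1‖⁻¹ • (![p, q, r] : Fin 3 → E3 × ℝ) i,
    ?_, ?_, ?_, ?_⟩
  · intro i
    rw [Prod.smul_fst, norm_smul, norm_inv, norm_norm]
    exact inv_mul_cancel₀ (norm_ne_zero_iff.mpr (hne i))
  · simp [inner_smul_left, hpu]
  · simp [inner_smul_left, hqu]
  · intro α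
    have e : (⋂ i, hsp (sg (α i)
        (‖((![p, q, r] : Fin 3 → E3 × ℝ) i).1‖⁻¹ • (![p, q, r] : Fin 3 → E3 × ℝ) i)))
        = hsp (sg (α 0) p) ∩ hsp (sg (α 1) q) ∩ hsp (sg (α 2) r) := by
      have : ∀ i, hsp (sg (α i)
          (‖((![p, q, r] : Fin 3 → E3 × ℝ) i).1‖⁻¹ • (![p, q, r] : Fin 3 → E3 × ℝ) i))
          = hsp (sg (α i) ((![p, q, r] : Fin 3 → E3 × ℝ) i)) := by
        intro i
        rw [sg_smul, hsp_smul (inv_pos.mpr (norm_pos_iff.mpr (hne i)))]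
      rw [Set.iInter_congr this]
      ext x
      simp [Fin.forall_fin_succ, and_assoc]
    rw [e]
    change mR μ (sg (α 0) p) (sg (α 1) q) (sg (α 2) r) = _
    cases α 0 <;> cases α 1 <;> cases α 2 <;> simp only [sg] <;> assumption

lemma planeNull_volume : PlaneNull (volume : Measure E3) := by
  intro v hv a
  let s : AffineSubspace ℝ E3 :=
    { carrier := {x | ⟪v, x⟫ = a}
      smul_vsub_vadd_mem' := by
        intro c x y z hx hy hz
        simp only [Set.mem_ofPred_eq] at *
        rw [vsub_eq_sub, vadd_eq_add, inner_add_right, inner_smul_right, inner_sub_right, hx, hy,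
          hz]
        ring }
  refine Measure.addHaar_affineSubspace volume s ?_
  intro h
  have hall : ∀ x : E3, ⟪v, x⟫ = a := by
    intro x
    have : x ∈ s := by rw [h]; trivial
    exact this
  have h0 := hall 0
  have h1 := hall v
  rw [inner_zero_right] at h0
  rw [← h0] at h1
  exact hv (inner_self_eq_zero.mp h1)

/-- a finite measure with full support -/
def gam : Measure E3 := (volume : Measure E3).toFinite

instance : IsFiniteMeasure gam := by unfold gam; infer_instance

lemma planeNull_gam : PlaneNull gam := by
  intro v hv a
  exact toFinite_apply_eq_zero_iff.mpr (planeNull_volume v hv a)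

lemma exists_K (μ : Measure E3) [IsFiniteMeasure μ] {ε : ℝ} (hε : 0 < ε) :
    ∃ K : ℝ, 0 ≤ K ∧ μ.real {x | K < ‖x‖} < ε := by
  have h : Filter.Tendsto (fun n : ℕ => μ {x : E3 | (n : ℝ) < ‖x‖}) Filter.atTop
      (nhds (μ ∅)) := by
    apply tendsto_measure_of_ae_tendsto_indicator_of_isFiniteMeasure
    · exact MeasurableSet.empty
    · intro n
      exact (isOpen_lt (by fun_prop) (by fun_prop)).measurableSet
    · filter_upwards with x
      filter_upwards [Filter.eventually_ge_atTop ⌈‖x‖⌉₊] with n hn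
      have : ‖x‖ ≤ n := (Nat.le_ceil _).trans (by exact_mod_cast hn)
      simpa using this
  have h2 := (ENNReal.tendsto_toReal (measure_ne_top μ _)).comp h
  rw [measure_empty, ENNReal.toReal_zero] at h2
  obtain ⟨n, hn⟩ := (h2.eventually_lt_const hε).exists
  exact ⟨n, n.cast_nonneg, hn⟩

lemma offset_bound (ν : Measure E3) [IsFiniteMeasure ν] {K m : ℝ}
    (hK : ν.real {x | K < ‖x‖} < m) (P : Fin 3 → E3 × ℝ) (hP : ∀ i, ‖(P i).1‖ = 1)
    (hα : ∀ α : Fin 3 → Bool, m ≤ ν.real (⋂ i, hsp (sg (α i) (P i)))) (i : Fin 3) :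
    (P i).2 ∈ Set.Icc (-K) K := by
  have key : ∀ x : E3, |⟪(P i).1, x⟫| ≤ ‖x‖ := by
    intro x
    simpa [hP i] using abs_real_inner_le_norm (P i).1 x
  constructor
  · by_contra! hlt
    refine absurd ((hα fun _ => false).trans (measureReal_mono ?_)) (not_le.mpr hK)
    intro x hx
    have hx := Set.mem_iInter.mp hx i
    simp only [sg] at hx
    have hx : ⟪(P i).1, x⟫ < (P i).2 := mem_hsp_neg.mp hx
    have := (abs_le.mp (key x)).1
    simp only [Set.mem_ofPred_eq]
    linarith
  · by_contra! hlt
    refine absurd ((hα fun _ => true).trans (measureReal_mono ?_)) (not_le.mpr hK)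
    intro x hx
    have hx := Set.mem_iInter.mp hx i
    simp only [sg] at hx
    have hx : (P i).2 < ⟪(P i).1, x⟫ := hx
    have := (abs_le.mp (key x)).2
    simp only [Set.mem_ofPred_eq]
    linarith

lemma limit_case (μ : Measure E3) [IsFiniteMeasure μ] (hn : PlaneNull μ)
    (hpos : 0 < μ.real Set.univ)
    (u e1 e2 : E3) (hu : ⟪u, u⟫ = 1) (h1 : ⟪e1, e1⟫ = 1) (h2 : ⟪e2, e2⟫ = 1)
    (h12 : ⟪e1, e2⟫ = 0) (h1u : ⟪e1, u⟫ = 0) (h2u : ⟪e2, u⟫ = 0) :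
    ∃ P : Fin 3 → E3 × ℝ, (∀ i, ‖(P i).1‖ = 1) ∧ ⟪(P 0).1, u⟫ = 0 ∧ ⟪(P 1).1, u⟫ = 0 ∧
      ∀ α : Fin 3 → Bool, μ.real (⋂ i, hsp (sg (α i) (P i))) = μ.real Set.univ / 8 := by
  let ε : ℕ → NNReal := fun n => 1 / ((n : NNReal) + 1)
  have hε0 : ∀ n, 0 < ε n := fun n => by positivity
  have hε1 : ∀ n, ε n ≤ 1 := by
    intro n
    apply div_le_one_of_le₀ <;> simp
  have hεt : Filter.Tendsto (fun n => (ε n : ℝ)) Filter.atTop (nhds 0) := by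
    have := tendsto_one_div_add_atTop_nhds_zero_nat (𝕜 := ℝ)
    simpa [ε] using this
  have hreal : ∀ n S, (μ + ε n • gam).real S = μ.real S + ε n * gam.real S := by
    intro n S
    rw [measureReal_add_apply, measureReal_nnreal_smul_apply]
  have hex : ∀ n, ∃ P : Fin 3 → E3 × ℝ,
      (∀ i, ‖(P i).1‖ = 1) ∧ ⟪(P 0).1, u⟫ = 0 ∧ ⟪(P 1).1, u⟫ = 0 ∧
      ∀ α : Fin 3 → Bool, (μ + ε n • gam).real (⋂ i, hsp (sg (α i) (P i)))
        = (μ + ε n • gam).real Set.univ / 8 := by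
    intro n
    have hnn : PlaneNull (μ + ε n • gam) := by
      intro v hv a
      simp [hn v hv a, planeNull_gam v hv a]
    have hop : (μ + ε n • gam).IsOpenPosMeasure := by
      refine Measure.IsOpenPosMeasure.mk ?_
      intro U hU hUn h0
      have h0' : gam U = 0 := by
        have hh : μ U = 0 ∧ gam U = 0 := by
          simpa [(hε0 n).ne'] using h0
        exact hh.2
      exact hU.measure_ne_zero volume hUn (toFinite_apply_eq_zero_iff.mp h0')
    exact full_support_norm _ hnn u e1 e2 hu h1 h2 h12 h1u h2u
  choose P hP1 hPu0 hPu1 hPm using hex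
  obtain ⟨K, hK0, hK⟩ := exists_K (μ + gam) (ε := μ.real Set.univ / 8) (by positivity)
  have hb : ∀ n i, (P n i).2 ∈ Set.Icc (-K) K := by
    intro n i
    refine offset_bound (μ + ε n • gam) (m := μ.real Set.univ / 8) (lt_of_le_of_lt ?_ hK) (P n)
      (hP1 n) ?_ i
    · rw [hreal, measureReal_add_apply]
      have : (ε n : ℝ) ≤ 1 := hε1 n
      nlinarith [measureReal_nonneg (μ := gam) (s := {x : E3 | K < ‖x‖})]
    · intro α
      rw [hPm n α, hreal]
      have : 0 ≤ (ε n : ℝ) * gam.real Set.univ := by positivity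
      linarith
  have hcomp : IsCompact (Set.pi Set.univ fun _ : Fin 3 =>
      Metric.closedBall (0 : E3) 1 ×ˢ Set.Icc (-K) K) :=
    isCompact_univ_pi fun _ => (isCompact_closedBall _ _).prod isCompact_Icc
  obtain ⟨Q, -, φ, hφ, hlim⟩ := hcomp.tendsto_subseq (x := P) (by
    intro n i _
    exact ⟨by simp [hP1 n i], hb n i⟩)
  have hlimi : ∀ i, Filter.Tendsto (fun n => P (φ n) i) Filter.atTop (nhds (Q i)) :=
    fun i => (tendsto_pi_nhds.mp hlim) i
  have hQ1 : ∀ i, ‖(Q i).1‖ = 1 := by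
    intro i
    have hc : Continuous fun p : E3 × ℝ => ‖p.1‖ := by fun_prop
    refine tendsto_nhds_unique ((hc.tendsto (Q i)).comp (hlimi i)) ?_
    simp [Function.comp_def, hP1]
  have hci : Continuous fun p : E3 × ℝ => ⟪p.1, u⟫ := by fun_prop
  refine ⟨Q, hQ1, ?_, ?_, ?_⟩
  · refine tendsto_nhds_unique ((hci.tendsto (Q 0)).comp (hlimi 0)) ?_
    simp [Function.comp_def, hPu0]
  · refine tendsto_nhds_unique ((hci.tendsto (Q 1)).comp (hlimi 1)) ?_
    simp [Function.comp_def, hPu1]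
  · intro α
    have ht := tendsto_inter μ hn Filter.atTop (fun n i => sg (α i) (P (φ n) i))
      (fun i => sg (α i) (Q i))
      (tendsto_pi_nhds.mpr fun i => ((continuous_sg (α i)).tendsto _).comp (hlimi i))
      (fun i => sg_fst_ne _ (by
        intro h0
        have := hQ1 i
        rw [h0, norm_zero] at this
        exact zero_ne_one this))
    have ht2 := (ENNReal.tendsto_toReal (measure_ne_top μ _)).comp ht
    refine tendsto_nhds_unique ht2 ?_
    have hεφ := hεt.comp hφ.tendsto_atTop
    have hz : Filter.Tendsto (fun n => (ε (φ n) : ℝ) * gam.real Set.univ) Filter.atTop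
        (nhds 0) := by
      simpa using hεφ.mul_const (gam.real Set.univ)
    have hdist : ∀ n, |μ.real (⋂ i, hsp (sg (α i) (P (φ n) i))) - μ.real Set.univ / 8|
        ≤ (ε (φ n) : ℝ) * gam.real Set.univ := by
      intro n
      have e := hPm (φ n) α
      rw [hreal, hreal] at e
      set S := ⋂ i, hsp (sg (α i) (P (φ n) i))
      have hS : gam.real S ≤ gam.real Set.univ := measureReal_mono (Set.subset_univ _)
      have hS0 : 0 ≤ gam.real S := measureReal_nonneg
      have hG0 : 0 ≤ gam.real Set.univ := measureReal_nonneg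
      have he : 0 ≤ (ε (φ n) : ℝ) := (ε (φ n)).2
      have a1 := mul_le_mul_of_nonneg_left hS he
      have a2 := mul_nonneg he hS0
      have a3 := mul_nonneg he hG0
      rw [abs_le]
      constructor <;> linarith
    have := squeeze_zero (fun n => abs_nonneg _) hdist hz
    have h3 := (tendsto_zero_iff_abs_tendsto_zero _).mpr this
    have h4 := h3.add_const (μ.real Set.univ / 8)
    simpa [Function.comp_def, Measure.real] using h4

lemma indep_of_parts (μ : Measure E3) [IsFiniteMeasure μ] (hpos : 0 < μ.real Set.univ)
    (P : Fin 3 → E3 × ℝ) (hP : ∀ i, ‖(P i).1‖ = 1)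
    (hm : ∀ α : Fin 3 → Bool, μ.real (⋂ i, hsp (sg (α i) (P i))) = μ.real Set.univ / 8) :
    LinearIndependent ℝ ![(P 0).1, (P 1).1] := by
  have hne : ∀ α : Fin 3 → Bool, (⋂ i, hsp (sg (α i) (P i))).Nonempty := by
    intro α
    by_contra h
    have := hm α
    rw [Set.not_nonempty_iff_eq_empty.mp h, measureReal_empty] at this
    linarith
  have h0 : (P 0).1 ≠ 0 := by
    intro h
    have := hP 0
    rw [h, norm_zero] at this
    exact zero_ne_one this
  rw [LinearIndependent.pair_iff' h0]
  intro a ha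
  have hx : ∀ α : Fin 3 → Bool, ∃ x : E3, x ∈ hsp (sg (α 0) (P 0)) ∧
      x ∈ hsp (sg (α 1) (P 1)) := by
    intro α
    obtain ⟨x, hx⟩ := hne α
    exact ⟨x, Set.mem_iInter.mp hx 0, Set.mem_iInter.mp hx 1⟩
  obtain ⟨x1, b1, c1⟩ := hx ![true, true, true]
  obtain ⟨x2, b2, c2⟩ := hx ![true, false, true]
  obtain ⟨x3, b3, c3⟩ := hx ![false, true, true]
  obtain ⟨x4, b4, c4⟩ := hx ![false, false, true]
  simp only [Matrix.cons_val_zero, Matrix.cons_val_one, sg, if_true, if_false,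
    Bool.false_eq_true, mem_hsp_neg] at b1 b2 b3 b4 c1 c2 c3 c4
  simp only [mem_hsp] at b1 b2 c1 c3
  rw [← ha, inner_smul_left] at c1 c2 c3 c4
  simp only [conj_trivial] at c1 c2 c3 c4
  rcases le_total 0 a with h | h
  · nlinarith [mul_le_mul_of_nonneg_left (b3.le.trans b2.le) h]
  · nlinarith [mul_le_mul_of_nonpos_left (b4.le.trans b1.le) h]

/-- Main topological theorem: for every mass distribution `μ` on ℝ³ and every unit vector
`u`, there is a triple of planes that eight-partitions `μ` such that the intersection of the
first two planes is a line with direction `u` (both normals are orthogonal to `u`, and the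
two planes are not parallel). -/
theorem stmt13 (μ : Measure E3) (hμ : IsMassDistribution μ) (u : E3) (hu : ‖u‖ = 1) :
    ∃ (v : Fin 3 → E3) (a : Fin 3 → ℝ), (∀ i, v i ≠ 0) ∧
      ⟪v 0, u⟫ = 0 ∧ ⟪v 1, u⟫ = 0 ∧ LinearIndependent ℝ ![v 0, v 1] ∧
      ∀ α : Fin 3 → Bool, μ (orthant v a α) = μ Set.univ / 8 := by
  obtain ⟨hfin, hn⟩ := hμ
  obtain ⟨b, hb⟩ := Orthonormal.exists_orthonormalBasis_extension_of_card_eq (𝕜 := ℝ) (E := E3)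
    (ι := Fin 3) (by simp) (v := fun _ => u) (s := {0}) (by
      rw [orthonormal_iff_ite]
      intro i j
      have : i = j := Subsingleton.elim _ _
      simp [this, hu])
  have hb0 : b 0 = u := hb 0 rfl
  have ho := orthonormal_iff_ite.mp b.orthonormal
  have huu : ⟪u, u⟫ = 1 := by rw [real_inner_self_eq_norm_sq, hu]; norm_num
  have h1 : ⟪b 1, b 1⟫ = 1 := by rw [ho]; simp
  have h2 : ⟪b 2, b 2⟫ = 1 := by rw [ho]; simp
  have h12 : ⟪b 1, b 2⟫ = 0 := by rw [ho]; simp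
  have h1u : ⟪b 1, u⟫ = 0 := by rw [← hb0, ho]; simp
  have h2u : ⟪b 2, u⟫ = 0 := by rw [← hb0, ho]; simp
  by_cases hpos : 0 < μ.real Set.univ
  · obtain ⟨P, hP, hP0, hP1, hm⟩ := limit_case μ hn hpos u (b 1) (b 2) huu h1 h2 h12 h1u h2u
    refine ⟨fun i => (P i).1, fun i => (P i).2, ?_, hP0, hP1, indep_of_parts μ hpos P hP hm, ?_⟩
    · intro i h
      have := hP i
      change (P i).1 = 0 at h
      rw [h, norm_zero] at this
      exact zero_ne_one this
    · intro α
      rw [orthant_eq]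
      have h := hm α
      unfold Measure.real at h
      rw [← ENNReal.toReal_eq_toReal_iff' (measure_ne_top _ _)
        (ENNReal.div_ne_top (measure_ne_top _ _) (by norm_num)), ENNReal.toReal_div]
      simpa using h
  · have hz : μ = 0 := by
      have h0 : μ.real Set.univ = 0 := le_antisymm (not_lt.mp hpos) measureReal_nonneg
      rw [measureReal_eq_zero_iff] at h0
      exact Measure.measure_univ_eq_zero.mp h0
    refine ⟨![b 1, b 2, u], 0, ?_, h1u, h2u, ?_, ?_⟩
    · intro i
      fin_cases i
      · exact b.orthonormal.ne_zero 1
      · exact b.orthonormal.ne_zero 2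
      · intro h
        change u = 0 at h
        rw [h, norm_zero] at hu
        exact zero_ne_one hu
    · have hne : b 1 ≠ 0 := b.orthonormal.ne_zero 1
      change LinearIndependent ℝ ![b 1, b 2]
      rw [LinearIndependent.pair_iff' hne]
      intro a ha
      rw [← ha, inner_smul_right, h1, mul_one] at h12
      rw [h12, zero_smul] at ha
      exact b.orthonormal.ne_zero 2 ha.symm
    · intro α
      simp [hz]
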